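/- arXiv:2105.13874 — 2 statements merged into one kernel-verified Lean document; each statement's English description precedes it below -/
import Mathlib

section
/- Let A ⊆ H be an affine commutative-by-finite Hopf algebra with A semiprime or central in H, or H pointed. Then the finite dual H° is a free module, both as a left module and as a right module, over the finite-dimensional normal Hopf subalgebra H̄* = {f ∈ H° : f(A⁺H) = 0}. -/
open TensorProduct LinearMap Coalgebra

namespace Paper

noncomputable section

variable (k : Type) [Field k]

section Coalg

variable {C : Type} [AddCommMonoid C] [Module k C] [Coalgebra k C]

/-- Convolution product on the linear dual of a coalgebra. -/
noncomputable def conv (f g : Module.Dual k C) : Module.Dual k C :=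
  (TensorProduct.lid k k).toLinearMap ∘ₗ TensorProduct.map f g ∘ₗ Coalgebra.comul

/-- The unit of the convolution algebra on the dual: the counit. -/
noncomputable def convOne : Module.Dual k C := Coalgebra.counit

/-- Iterated convolution power. -/
noncomputable def convPow (f : Module.Dual k C) : ℕ → Module.Dual k C
  | 0 => convOne k
  | n + 1 => conv k f (convPow f n)

end Coalg

/-- The finite dual of an algebra: functionals vanishing on a two-sided ideal
of finite codimension. -/
def finDual (H : Type) [Ring H] [Algebra k H] : Set (Module.Dual k H) :=
  {f | ∃ I : Submodule k H, (∀ (h : H), ∀ x ∈ I, h * x ∈ I ∧ x * h ∈ I) ∧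
    I ≤ LinearMap.ker f ∧ FiniteDimensional k (H ⧸ I)}

section Hopf

variable (H : Type) [Ring H] [HopfAlgebra k H]

/-- Left adjoint action `(ad_ℓ h)(a) = Σ h₁ a S(h₂)`. -/
noncomputable def adl (h a : H) : H :=
  TensorProduct.lift (((LinearMap.mul k H).comp (LinearMap.mulRight k a)).compl₂
    (HopfAlgebra.antipode (R := k))) (Coalgebra.comul h)

/-- Right adjoint action `(ad_r h)(a) = Σ S(h₁) a h₂`. -/
noncomputable def adr (h a : H) : H :=
  TensorProduct.lift ((LinearMap.mul k H).comp ((LinearMap.mulRight k a) ∘ₗ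
    (HopfAlgebra.antipode (R := k)))) (Coalgebra.comul h)

/-- Left adjoint action on the dual: `(ad_ℓ φ)(f) = Σ φ₁ f S°(φ₂)`, i.e.
`h ↦ Σ φ(h₁ S(h₃)) f(h₂)`. -/
noncomputable def adld (φ f : Module.Dual k H) : Module.Dual k H :=
  (TensorProduct.lid k k).toLinearMap ∘ₗ
    TensorProduct.map (φ ∘ₗ LinearMap.mul' k H ∘ₗ
      (HopfAlgebra.antipode (R := k)).lTensor H) f ∘ₗ
    (TensorProduct.assoc k H H H).symm.toLinearMap ∘ₗ
    ((TensorProduct.comm k H H).toLinearMap.lTensor H) ∘ₗ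
    ((Coalgebra.comul (R := k) (A := H)).lTensor H) ∘ₗ
    Coalgebra.comul

/-- Right adjoint action on the dual: `(ad_r φ)(f) = Σ S°(φ₁) f φ₂`, i.e.
`h ↦ Σ φ(S(h₁) h₃) f(h₂)`. -/
noncomputable def adrd (φ f : Module.Dual k H) : Module.Dual k H :=
  (TensorProduct.lid k k).toLinearMap ∘ₗ
    TensorProduct.map (φ ∘ₗ LinearMap.mul' k H ∘ₗ
      (HopfAlgebra.antipode (R := k)).rTensor H) f ∘ₗ
    (TensorProduct.assoc k H H H).symm.toLinearMap ∘ₗ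
    ((TensorProduct.comm k H H).toLinearMap.lTensor H) ∘ₗ
    ((Coalgebra.comul (R := k) (A := H)).lTensor H) ∘ₗ
    Coalgebra.comul

/-- A submodule is a subcoalgebra if its image under `comul` lies in `V ⊗ V`. -/
def IsSubcoalgebra (V : Submodule k H) : Prop :=
  ∀ x ∈ V, Coalgebra.comul (R := k) x ∈
    LinearMap.range (TensorProduct.map V.subtype V.subtype)

/-- A Hopf algebra is pointed if every simple subcoalgebra is one-dimensional. -/
def IsPointedHopf : Prop :=
  ∀ V : Submodule k H, IsSubcoalgebra k H V → V ≠ ⊥ →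
    (∀ W : Submodule k H, W ≤ V → IsSubcoalgebra k H W → W = ⊥ ∨ W = V) →
    Module.finrank k ↥V = 1

/-- A coideal: `ε(X) = 0` and `Δ(X) ⊆ X ⊗ H + H ⊗ X`. -/
def IsCoideal (X : Submodule k H) : Prop :=
  (∀ x ∈ X, Coalgebra.counit (R := k) x = 0) ∧
  (∀ x ∈ X, Coalgebra.comul (R := k) x ∈
    LinearMap.range (TensorProduct.map X.subtype (LinearMap.id (M := H))) ⊔
    LinearMap.range (TensorProduct.map (LinearMap.id (M := H)) X.subtype))

/-- `S` is a Hopf subalgebra of the finite dual `H°` (with its convolution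
product; closure under the coproduct is expressed in pairing form). -/
def IsHopfSubalgSet (S : Set (Module.Dual k H)) : Prop :=
  S ⊆ finDual k H ∧ convOne k ∈ S ∧
  (∀ f g, f ∈ S → g ∈ S → f + g ∈ S ∧ conv k f g ∈ S) ∧
  (∀ (c : k), ∀ f ∈ S, c • f ∈ S) ∧
  (∀ f ∈ S, f ∘ₗ HopfAlgebra.antipode (R := k) ∈ S) ∧
  (∀ f ∈ S, ∃ (n : ℕ) (s t : Fin n → Module.Dual k H),
    (∀ i, s i ∈ S ∧ t i ∈ S) ∧ ∀ x y : H, f (x * y) = ∑ i, s i x * t i y)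

end Hopf

section Ext

variable (A : Type) [CommRing A] [HopfAlgebra k A]
variable (H : Type) [Ring H] [HopfAlgebra k H]

/-- The submodule `A⁺H` of `H` (image of the augmentation ideal times `H`). -/
def augHIdeal (ι : A →ₗ[k] H) : Submodule k H :=
  Submodule.span k
    {x : H | ∃ (a : A) (h : H), Coalgebra.counit (R := k) a = 0 ∧ x = ι a * h}

/-- The subset of the dual of `H` corresponding to `H̄* = (H/A⁺H)*`:
functionals vanishing on `A⁺H`. -/
def hbarStar (ι : A →ₗ[k] H) : Set (Module.Dual k H) :=
  {f | ∀ x ∈ augHIdeal k A H ι, f x = 0}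

/-- The tangential component `W(H°)`. -/
def tangential (ι : A →ₗ[k] H) : Set (Module.Dual k H) :=
  {f | f ∈ finDual k H ∧ ∃ n : ℕ, 0 < n ∧ ∀ x ∈ (augHIdeal k A H ι) ^ n, f x = 0}

/-- The augmentation ideal of the commutative Hopf algebra `A`. -/
def augIdeal : Ideal A := RingHom.ker (Bialgebra.counitAlgHom k A)

/-- The irreducible component `A'` of `A°` containing the counit:
functionals vanishing on a power of the augmentation ideal. -/
def Aprime : Set (Module.Dual k A) :=
  {f | ∃ n : ℕ, 0 < n ∧ ∀ x ∈ (augIdeal k A) ^ n, f x = 0}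

/-- The Lie algebra `𝔤` of `G_H`: primitive functionals on `A`. -/
def gLie : Set (Module.Dual k A) :=
  {f | f 1 = 0 ∧ ∀ x y : A, f (x * y) =
    f x * Coalgebra.counit (R := k) y + Coalgebra.counit (R := k) x * f y}

/-- An ideal of `A` is `H̄`-stable if it is stable under the (left) adjoint
action of `H` on `A` (which factors through `H̄`). -/
def IsHStable (ι : A →ₗ[k] H) (I : Ideal A) : Prop :=
  ∀ (h : H), ∀ a ∈ I, ∃ b ∈ I, ι b = adl k H h (ι a)

/-- `mc` is the `H̄`-core of `m`: the largest `H̄`-stable ideal of `A`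
contained in `m`. -/
def IsCore (ι : A →ₗ[k] H) (m mc : Ideal A) : Prop :=
  IsHStable k A H ι mc ∧ mc ≤ m ∧
    ∀ I : Ideal A, IsHStable k A H ι I → I ≤ m → I ≤ mc

/-- The submodule `H·J` of `H`, for an ideal `J` of `A`. -/
def leftMul (ι : A →ₗ[k] H) (J : Ideal A) : Submodule k H :=
  Submodule.span k {x : H | ∃ (h : H), ∃ a ∈ J, x = h * ι a}

/-- The submodule `J·H` of `H`, for an ideal `J` of `A`. -/
def rightMul (ι : A →ₗ[k] H) (J : Ideal A) : Submodule k H :=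
  Submodule.span k {x : H | ∃ (h : H), ∃ a ∈ J, x = ι a * h}

/-- The subcoalgebra `ĝ := (H/H m_g^{(H̄)})*` of `H°`, as a submodule of the dual. -/
def ghat (ι : A →ₗ[k] H) (core : Ideal A → Ideal A) (g : A →ₐ[k] k) :
    Submodule k (Module.Dual k H) :=
  (leftMul k A H ι (core (RingHom.ker g))).dualAnnihilator

/-- The character component `k̂G_H` of `H°`. -/
def charComp (ι : A →ₗ[k] H) (core : Ideal A → Ideal A) :
    Set (Module.Dual k H) :=
  {f | ∃ s : Finset (A →ₐ[k] k), s.Nonempty ∧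
    ∀ x ∈ ⨅ g ∈ s, leftMul k A H ι (core (RingHom.ker g)), f x = 0}

/-- Hypothesis (OrbSemi): all orbit algebras `A/m^{(H̄)}` are semisimple. -/
def OrbSemi (core : Ideal A → Ideal A) : Prop :=
  ∀ m : Ideal A, m.IsMaximal → IsSemisimpleRing (A ⧸ core m)

/-- Restriction of functionals along `ι` : the map `ι° : H° → A°`. -/
def iotaDual (ι : A →ₗ[k] H) (f : Module.Dual k H) : Module.Dual k A := f ∘ₗ ι

/-- Coextension of functionals along the projection `Π : H → A`:
the map `Π° : A° → H°`. -/
def PiDual (p : H →ₗ[k] A) (α : Module.Dual k A) : Module.Dual k H := α ∘ₗ p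

/-- `A ⊆ H` is an affine commutative-by-finite Hopf algebra, where the
inclusion of the commutative normal Hopf subalgebra `A` is recorded by the
injective Hopf algebra map `ι`. -/
structure CommByFinite (ι : A →ₗ[k] H) : Prop where
  ι_inj : Function.Injective ι
  ι_one : ι 1 = 1
  ι_mul : ∀ a b : A, ι (a * b) = ι a * ι b
  ι_comul : ∀ a : A,
    Coalgebra.comul (R := k) (ι a) = TensorProduct.map ι ι (Coalgebra.comul a)
  ι_counit : ∀ a : A,
    Coalgebra.counit (R := k) (ι a) = Coalgebra.counit (R := k) a
  ι_antipode : ∀ a : A,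
    ι (HopfAlgebra.antipode (R := k) a) = HopfAlgebra.antipode (R := k) (ι a)
  affine : ∃ s : Finset A, Algebra.adjoin k (s : Set A) = ⊤
  normal_left : ∀ (h : H) (a : A), adl k H h (ι a) ∈ Set.range ι
  normal_right : ∀ (h : H) (a : A), adr k H h (ι a) ∈ Set.range ι
  finiteOver : ∃ s : Finset H,
    Submodule.span k {x : H | ∃ (a : A), ∃ y ∈ s, x = ι a * y} = ⊤

/-- The standing hypothesis: `A` is semiprime (reduced) or central in `H`,
or `H` is pointed. -/
def StandingHyp (ι : A →ₗ[k] H) : Prop :=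
  IsReduced A ∨ (∀ (a : A) (h : H), ι a * h = h * ι a) ∨ IsPointedHopf k H

/-- `Π : H → A` is the projection of a direct sum decomposition
`H = A ⊕ X` of right `A`-modules. -/
structure IsSplitting (ι : A →ₗ[k] H) (p : H →ₗ[k] A) : Prop where
  left_inv : ∀ a : A, p (ι a) = a
  right_linear : ∀ (h : H) (a : A), p (h * ι a) = p h * a

/-- Hypothesis (CoSplit) for a given splitting `Π`: the complement
`X = ker Π` is a coideal of `H`. -/
def CoSplit (p : H →ₗ[k] A) : Prop := IsCoideal k H (LinearMap.ker p)

end Ext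

section Quot

variable (A : Type) [CommRing A] [HopfAlgebra k A]
variable (H : Type) [Ring H] [HopfAlgebra k H]
variable (Hb : Type) [Ring Hb] [HopfAlgebra k Hb]

/-- `π : H → H̄` realises `H̄` as the quotient Hopf algebra `H/A⁺H`. -/
structure IsHbarQuotient (ι : A →ₗ[k] H) (π : H →ₗ[k] Hb) : Prop where
  π_surj : Function.Surjective π
  π_one : π 1 = 1
  π_mul : ∀ x y : H, π (x * y) = π x * π y
  π_comul : ∀ x : H,
    Coalgebra.comul (R := k) (π x) = TensorProduct.map π π (Coalgebra.comul x)
  π_counit : ∀ x : H,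
    Coalgebra.counit (R := k) (π x) = Coalgebra.counit (R := k) x
  π_antipode : ∀ x : H,
    π (HopfAlgebra.antipode (R := k) x) = HopfAlgebra.antipode (R := k) (π x)
  π_ker : LinearMap.ker π = augHIdeal k A H ι
  findim : FiniteDimensional k Hb

/-- Composition with `π` : the map `π° : H̄* → H°`. -/
def piDual (π : H →ₗ[k] Hb) (β : Module.Dual k Hb) : Module.Dual k H := β ∘ₗ π

end Quot

end

end Paper

namespace NZ
noncomputable section

section basic
variable {k B M : Type} [Field k] [Ring B] [Algebra k B]
  [AddCommGroup M] [Module k M] [Module B M] [IsScalarTower k B M]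
variable {X Y : Type} [AddCommGroup X] [Module k X] [Module B X] [IsScalarTower k B X]
  [AddCommGroup Y] [Module k Y] [Module B Y] [IsScalarTower k B Y]

variable (k B M X) in
def hh : ℕ := Module.finrank k (M →ₗ[B] X)

def resInj : (M →ₗ[B] X) →ₗ[k] (M →ₗ[k] X) where
  toFun f := f.restrictScalars k
  map_add' _ _ := rfl
  map_smul' _ _ := rfl

lemma resInj_inj : Function.Injective (resInj (k := k) (B := B) (M := M) (X := X)) := by
  intro f g h
  ext m
  exact congrArg (fun t => t m) h

instance homFD [FiniteDimensional k M] [FiniteDimensional k X] :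
    FiniteDimensional k (M →ₗ[B] X) :=
  FiniteDimensional.of_injective resInj resInj_inj

lemma hh_le [FiniteDimensional k M] [FiniteDimensional k X] :
    hh k B M X ≤ Module.finrank k M * Module.finrank k X := by
  rw [← Module.finrank_linearMap k k M X]
  exact LinearMap.finrank_le_finrank_of_injective resInj_inj

variable (k M) in
def post (g : X →ₗ[B] Y) : (M →ₗ[B] X) →ₗ[k] (M →ₗ[B] Y) where
  toFun f := g ∘ₗ f
  map_add' _ _ := by ext; simp
  map_smul' _ _ := by
    ext
    simp [LinearMap.map_smul_of_tower]

lemma hh_mono [FiniteDimensional k M] [FiniteDimensional k Y] (g : X →ₗ[B] Y)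
    (hg : Function.Injective g) : hh k B M X ≤ hh k B M Y := by
  refine LinearMap.finrank_le_finrank_of_injective (f := post k M g) ?_
  intro a b h
  ext m
  exact hg (congrArg (fun t => t m) h)

lemma hh_congr [FiniteDimensional k M] [FiniteDimensional k Y] (e : X ≃ₗ[B] Y) :
    hh k B M X = hh k B M Y := by
  have : FiniteDimensional k X :=
    FiniteDimensional.of_injective (e.toLinearMap.restrictScalars k) e.injective
  exact le_antisymm (hh_mono e.toLinearMap e.injective) (hh_mono e.symm.toLinearMap e.symm.injective)

lemma dim_congr (e : X ≃ₗ[B] Y) : Module.finrank k X = Module.finrank k Y :=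
  (e.restrictScalars k).finrank_eq

lemma dim_exact [FiniteDimensional k X] (N : Submodule B X) :
    Module.finrank k X = Module.finrank k N + Module.finrank k (X ⧸ N) := by
  have h := LinearMap.finrank_range_add_finrank_ker ((N.mkQ).restrictScalars k)
  have h1 : LinearMap.range ((N.mkQ).restrictScalars k) = ⊤ :=
    LinearMap.range_eq_top.2 N.mkQ_surjective
  have h2 : LinearMap.ker ((N.mkQ).restrictScalars k) = N.restrictScalars k := by
    ext x; simp
  rw [h1, h2, finrank_top] at h
  have h3 : Module.finrank k (N.restrictScalars k) = Module.finrank k N := rfl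
  omega

lemma hh_exact [FiniteDimensional k M] [FiniteDimensional k X] (N : Submodule B X) :
    hh k B M X ≤ hh k B M N + hh k B M (X ⧸ N) := by
  have : FiniteDimensional k (X ⧸ N) := FiniteDimensional.of_surjective
    ((N.mkQ).restrictScalars k) N.mkQ_surjective
  have : FiniteDimensional k N := FiniteDimensional.of_injective
    ((N.subtype).restrictScalars k) N.subtype_injective
  have h := LinearMap.finrank_range_add_finrank_ker (post k M N.mkQ)
  have h1 : Module.finrank k (LinearMap.range (post k M N.mkQ)) ≤ hh k B M (X ⧸ N) :=
    Submodule.finrank_le _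
  have h2 : LinearMap.ker (post k M N.mkQ) ≤ LinearMap.range (post k M N.subtype) := by
    intro f hf
    have : ∀ m, f m ∈ N := by
      intro m
      have := congrArg (fun t => t m) (LinearMap.mem_ker.1 hf)
      simpa [post] using this
    exact ⟨f.codRestrict N this, by ext; rfl⟩
  have h3 := Submodule.finrank_mono h2
  have h4 : Module.finrank k (LinearMap.range (post k M N.subtype)) ≤ hh k B M N :=
    LinearMap.finrank_range_le _
  unfold hh at *
  omega

lemma hh_pow [FiniteDimensional k M] [FiniteDimensional k X] (n : ℕ) :
    n * hh k B M X ≤ hh k B M (Fin n → X) := by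
  let Φ : (Fin n → (M →ₗ[B] X)) →ₗ[k] (M →ₗ[B] (Fin n → X)) :=
    { toFun := fun φ => LinearMap.pi φ
      map_add' := fun _ _ => rfl
      map_smul' := fun _ _ => rfl }
  have hΦ : Function.Injective Φ := by
    intro a b h
    funext i
    ext m
    exact congrFun (congrArg (fun t => t m) h) i
  have := LinearMap.finrank_le_finrank_of_injective hΦ
  rw [Module.finrank_pi_fintype] at this
  simpa [hh] using this

end basic

section ratio
variable (k B M : Type) [Field k] [Ring B] [Algebra k B] [FiniteDimensional k B]
  [AddCommGroup M] [Module k M] [Module B M] [IsScalarTower k B M] [FiniteDimensional k M]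

instance quotFD (I : Submodule B B) : FiniteDimensional k (B ⧸ I) :=
  FiniteDimensional.of_surjective ((I.mkQ).restrictScalars k) I.mkQ_surjective

lemma exists_max [Nontrivial B] : ∃ I₀ : Submodule B B, I₀ ≠ ⊤ ∧
    ∀ I : Submodule B B, I ≠ ⊤ → hh k B M (B ⧸ I) * Module.finrank k (B ⧸ I₀) ≤
      hh k B M (B ⧸ I₀) * Module.finrank k (B ⧸ I) := by
  have pos : ∀ I : Submodule B B, I ≠ ⊤ → 0 < Module.finrank k (B ⧸ I) := by
    intro I hI
    have : Nontrivial (B ⧸ I) := Submodule.Quotient.nontrivial_iff.2 hI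
    exact Module.finrank_pos
  let g : Submodule B B → ℕ × ℕ := fun I => (hh k B M (B ⧸ I), Module.finrank k (B ⧸ I))
  let r : ℕ × ℕ → ℚ := fun p => p.1 / p.2
  let S : Set (ℕ × ℕ) := g '' {I | I ≠ ⊤}
  have hle : ∀ I : Submodule B B, Module.finrank k (B ⧸ I) ≤ Module.finrank k B := fun I => by
    have := dim_exact (k := k) I; omega
  have hS : S.Finite := by
    refine Set.Finite.subset ((Finset.range (Module.finrank k M * Module.finrank k B + 1) ×ˢ
      Finset.range (Module.finrank k B + 1)).finite_toSet) ?_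
    rintro _ ⟨I, -, rfl⟩
    have h1 := hle I
    have h2 := hh_le (k := k) (B := B) (M := M) (X := B ⧸ I)
    have h3 := Nat.mul_le_mul_left (Module.finrank k M) h1
    simp [g]
    omega
  have hne : S.Nonempty := ⟨_, ⊥, bot_ne_top, rfl⟩
  obtain ⟨_, ⟨I₀, hI₀, rfl⟩, hmax⟩ := Set.exists_max_image S r hS hne
  refine ⟨I₀, hI₀, fun I hI => ?_⟩
  have := hmax _ ⟨I, hI, rfl⟩
  simp only [r, g] at this
  rw [div_le_div_iff₀ (by exact_mod_cast pos I hI) (by exact_mod_cast pos I₀ hI₀)] at this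
  exact_mod_cast this

variable {k B M}

lemma ratio_all {p q : ℕ} (hpq : ∀ I : Submodule B B, I ≠ ⊤ →
      hh k B M (B ⧸ I) * q ≤ p * Module.finrank k (B ⧸ I)) (n : ℕ) :
    ∀ (X : Type) [AddCommGroup X] [Module k X] [Module B X] [IsScalarTower k B X]
      [FiniteDimensional k X], Module.finrank k X = n →
      hh k B M X * q ≤ p * Module.finrank k X := by
  induction n using Nat.strong_induction_on with
  | _ n ih =>
  intro X _ _ _ _ _ hn
  by_cases hX : Subsingleton X
  · have : hh k B M X ≤ 0 := by
      have := hh_le (k := k) (B := B) (M := M) (X := X)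
      rwa [Module.finrank_zero_of_subsingleton (M := X), Nat.mul_zero] at this
    rw [Nat.le_zero.1 this]; simp
  · obtain ⟨x, hx⟩ : ∃ x : X, x ≠ 0 := by
      by_contra! h
      exact hX ⟨fun a b => by rw [h a, h b]⟩
    let f : B →ₗ[B] X := LinearMap.toSpanSingleton B X x
    let N := LinearMap.range f
    have : FiniteDimensional k N := FiniteDimensional.of_injective
      ((N.subtype).restrictScalars k) N.subtype_injective
    have : FiniteDimensional k (X ⧸ N) := FiniteDimensional.of_surjective
      ((N.mkQ).restrictScalars k) N.mkQ_surjective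
    have hxN : x ∈ N := ⟨1, by simp [f]⟩
    have e : (B ⧸ LinearMap.ker f) ≃ₗ[B] N := f.quotKerEquivRange
    have hI : LinearMap.ker f ≠ ⊤ := by
      intro h
      have : (1 : B) ∈ LinearMap.ker f := by rw [h]; trivial
      simp [f] at this
      exact hx this
    have h1 := hpq _ hI
    rw [hh_congr e, dim_congr e] at h1
    have hNpos : 0 < Module.finrank k N := by
      have : Nontrivial N := ⟨⟨x, hxN⟩, 0, fun h => hx (congrArg Subtype.val h)⟩
      exact Module.finrank_pos
    have hd := dim_exact (k := k) N
    have h2 := ih (Module.finrank k (X ⧸ N)) (by omega) (X ⧸ N) rfl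
    have h3 := hh_exact (k := k) (M := M) N
    rw [hd]
    nlinarith [Nat.mul_le_mul_right q h3]

end ratio

end
end NZ

namespace NZ
noncomputable section

section tw
variable {k B : Type} [Field k] [Ring B] [Algebra k B] {v : ℕ}

/-- Twisted module. -/
def Tw (_ρ : B →ₐ[k] Matrix (Fin v) (Fin v) B) (X : Type) : Type := Fin v → X

variable (ρ : B →ₐ[k] Matrix (Fin v) (Fin v) B) (X : Type) [AddCommGroup X]
  [Module k X] [Module B X] [IsScalarTower k B X]

instance : AddCommGroup (Tw ρ X) := inferInstanceAs (AddCommGroup (Fin v → X))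
instance : Module k (Tw ρ X) := inferInstanceAs (Module k (Fin v → X))
instance [FiniteDimensional k X] : FiniteDimensional k (Tw ρ X) :=
  inferInstanceAs (FiniteDimensional k (Fin v → X))

instance : Module B (Tw ρ X) where
  smul b x := fun i => ∑ j, ρ b i j • x j
  one_smul x := by
    funext i
    change ∑ j, ρ 1 i j • x j = x i
    simp only [map_one, Matrix.one_apply, ite_smul, one_smul, zero_smul]
    exact (Finset.sum_ite_eq Finset.univ i x).trans (by simp)
  mul_smul a b x := by
    funext i
    change ∑ j, ρ (a * b) i j • x j = ∑ j, ρ a i j • ∑ l, ρ b j l • x l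
    simp only [map_mul, Matrix.mul_apply, Finset.sum_smul, Finset.smul_sum, mul_smul]
    exact Finset.sum_comm
  smul_zero b := by
    funext i
    change ∑ j, ρ b i j • (0 : X) = 0
    simp
  smul_add b x y := by
    funext i
    change ∑ j, ρ b i j • (x j + y j) = ∑ j, ρ b i j • x j + ∑ j, ρ b i j • y j
    simp [Finset.sum_add_distrib]
  add_smul a b x := by
    funext i
    change ∑ j, ρ (a + b) i j • x j = ∑ j, ρ a i j • x j + ∑ j, ρ b i j • x j
    simp [Finset.sum_add_distrib, add_smul]
  zero_smul x := by
    funext i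
    change ∑ j, ρ 0 i j • x j = 0
    simp

lemma tw_smul (b : B) (x : Tw ρ X) (i : Fin v) : (b • x) i = ∑ j, ρ b i j • x j := rfl

instance : IsScalarTower k B (Tw ρ X) where
  smul_assoc c b x := by
    funext i
    change ∑ j, ρ (c • b) i j • x j = c • ∑ j, ρ b i j • x j
    simp [Finset.smul_sum]

lemma dim_tw [FiniteDimensional k X] : Module.finrank k (Tw ρ X) = v * Module.finrank k X := by
  change Module.finrank k (Fin v → X) = _
  rw [Module.finrank_pi_fintype]
  simp

variable {M : Type} [AddCommGroup M] [Module k M] [Module B M] [IsScalarTower k B M]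

lemma hh_tw [FiniteDimensional k M] [FiniteDimensional k X]
    (C C' : Fin v → Fin v → (M →ₗ[k] M))
    (h1 : ∀ i j b m, C i j (b • m) = ∑ l, ρ b i l • C l j m)
    (h2 : ∀ j p m, ∑ i, C i j (C' p i m) = if p = j then m else 0) :
    v * hh k B M X ≤ hh k B M (Tw ρ X) := by
  let Φ : (Fin v → (M →ₗ[B] X)) →ₗ[k] (M →ₗ[B] (Tw ρ X)) :=
    { toFun := fun φ =>
        { toFun := fun e => fun i => ∑ j, φ j (C i j e)
          map_add' := fun a b => by
            funext i
            change _ = (∑ j, φ j (C i j a)) + (∑ j, φ j (C i j b))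
            simp [Finset.sum_add_distrib]
          map_smul' := fun b a => by
            funext i
            change ∑ j, φ j (C i j (b • a)) = ∑ l, ρ b i l • ∑ j, φ j (C l j a)
            simp only [h1, map_sum, map_smul, Finset.smul_sum]
            exact Finset.sum_comm }
      map_add' := fun a b => by
        ext m
        funext i
        change (∑ j, (a j + b j) (C i j m)) = (∑ j, a j (C i j m)) + (∑ j, b j (C i j m))
        simp [Finset.sum_add_distrib]
      map_smul' := fun c a => by
        ext m
        funext i
        change (∑ j, (c • a j) (C i j m)) = c • (∑ j, a j (C i j m))
        simp [Finset.smul_sum] }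
  have hΦ : Function.Injective Φ := by
    rw [injective_iff_map_eq_zero]
    intro φ h
    have h0 : ∀ m i, ∑ j, φ j (C i j m) = 0 := fun m i => congrFun (congrArg (fun t => t m) h) i
    funext p
    ext m
    have : ∑ i, ∑ j, φ j (C i j (C' p i m)) = 0 := by simp [h0]
    rw [Finset.sum_comm] at this
    simp only [← map_sum, h2] at this
    simpa [apply_ite] using this
  have := LinearMap.finrank_le_finrank_of_injective hΦ
  rw [Module.finrank_pi_fintype] at this
  simpa [hh] using this

end tw

section bdual
variable {k B : Type} [Field k] [Ring B] [Algebra k B]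

variable (k B) in
def BD : Type := Module.Dual k B

def BD.f (x : BD k B) : B →ₗ[k] k := x

instance : AddCommGroup (BD k B) := inferInstanceAs (AddCommGroup (Module.Dual k B))
instance : Module k (BD k B) := inferInstanceAs (Module k (Module.Dual k B))
instance [FiniteDimensional k B] : FiniteDimensional k (BD k B) :=
  inferInstanceAs (FiniteDimensional k (Module.Dual k B))

instance : Module B (BD k B) where
  smul b f := LinearMap.comp (R₁ := k) (BD.f f) (LinearMap.mulRight k b)
  one_smul x := by
    refine LinearMap.ext fun a => ?_
    change (BD.f x) (a * 1) = (BD.f x) a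
    rw [mul_one]
  mul_smul a b x := by
    refine LinearMap.ext fun c => ?_
    change (BD.f x) (c * (a * b)) = (BD.f x) (c * a * b)
    rw [mul_assoc]
  smul_zero b := rfl
  smul_add b x y := rfl
  add_smul a b x := by
    refine LinearMap.ext fun c => ?_
    change (BD.f x) (c * (a + b)) = (BD.f x) (c * a) + (BD.f x) (c * b)
    rw [mul_add, map_add]
  zero_smul x := by
    refine LinearMap.ext fun c => ?_
    change (BD.f x) (c * 0) = 0
    rw [mul_zero, map_zero]

instance : IsScalarTower k B (BD k B) where
  smul_assoc c b x := by
    refine LinearMap.ext fun a => ?_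
    change (BD.f x) (a * (c • b)) = c • (BD.f x) (a * b)
    rw [Algebra.mul_smul_comm, map_smul]

variable {M : Type} [AddCommGroup M] [Module k M] [Module B M] [IsScalarTower k B M]

lemma hh_bd [FiniteDimensional k M] [FiniteDimensional k B] :
    hh k B M (BD k B) ≤ Module.finrank k M := by
  rw [← Subspace.dual_finrank_eq (K := k) (V := M)]
  let Φ : (M →ₗ[B] (BD k B)) →ₗ[k] Module.Dual k M :=
    { toFun := fun φ =>
        { toFun := fun m => (BD.f (φ m)) 1
          map_add' := fun a b => by rw [map_add]; rfl
          map_smul' := fun c a => by rw [LinearMap.map_smul_of_tower]; rfl }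
      map_add' := fun a b => rfl
      map_smul' := fun a b => rfl }
  refine LinearMap.finrank_le_finrank_of_injective (f := Φ) ?_
  rw [injective_iff_map_eq_zero]
  intro φ h
  ext m
  refine LinearMap.ext fun b => ?_
  have : (BD.f (φ (b • m))) 1 = 0 := congrArg (fun t => t (b • m)) h
  rw [map_smul] at this
  change (BD.f (φ m)) (1 * b) = 0 at this
  rwa [one_mul] at this

end bdual

end
end NZ

namespace NZ
noncomputable section

section main
variable {k B M : Type} [Field k] [Ring B] [Algebra k B] [FiniteDimensional k B]
  [AddCommGroup M] [Module k M] [Module B M] [IsScalarTower k B M] [FiniteDimensional k M]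

lemma InC_exact {p q : ℕ} (hall : ∀ (X : Type) [AddCommGroup X] [Module k X] [Module B X]
      [IsScalarTower k B X] [FiniteDimensional k X], hh k B M X * q ≤ p * Module.finrank k X)
    {X : Type} [AddCommGroup X] [Module k X] [Module B X]
    [IsScalarTower k B X] [FiniteDimensional k X] (hX : hh k B M X * q = p * Module.finrank k X)
    (N : Submodule B X) : hh k B M N * q = p * Module.finrank k N ∧
      hh k B M (X ⧸ N) * q = p * Module.finrank k (X ⧸ N) := by
  have : FiniteDimensional k N := FiniteDimensional.of_injective
    ((N.subtype).restrictScalars k) N.subtype_injective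
  have : FiniteDimensional k (X ⧸ N) := FiniteDimensional.of_surjective
    ((N.mkQ).restrictScalars k) N.mkQ_surjective
  have h1 := hall N
  have h2 := hall (X ⧸ N)
  have h3 := hh_exact (k := k) (M := M) N
  have h4 := dim_exact (k := k) N
  have h5 := Nat.mul_le_mul_right q h3
  rw [hX, h4] at h5
  constructor <;> nlinarith

lemma hh_const {v : ℕ} (ρ : B →ₐ[k] Matrix (Fin v) (Fin v) B)
    (C C' : Fin v → Fin v → (M →ₗ[k] M))
    (h1 : ∀ i j b m, C i j (b • m) = ∑ l, ρ b i l • C l j m)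
    (h2 : ∀ j p m, ∑ i, C i j (C' p i m) = if p = j then m else 0)
    (h3 : ∀ I : Submodule B B, I ≠ ⊤ → ∀ b, (∀ i j, ρ b i j ∈ I) → b = 0)
    (ε : B →ₐ[k] k) : ∃ c : ℕ, ∀ (Y : Type) [AddCommGroup Y] [Module k Y] [Module B Y]
      [IsScalarTower k B Y] [FiniteDimensional k Y],
      hh k B M Y = c * Module.finrank k Y := by
  have : Nontrivial B := ε.toRingHom.domain_nontrivial
  obtain ⟨I₀, hI₀, hmax⟩ := exists_max k B M
  set p := hh k B M (B ⧸ I₀) with hp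
  set q := Module.finrank k (B ⧸ I₀) with hq
  have hqpos : 0 < q := by
    have : Nontrivial (B ⧸ I₀) := Submodule.Quotient.nontrivial_iff.2 hI₀
    exact Module.finrank_pos
  have hall : ∀ (X : Type) [AddCommGroup X] [Module k X] [Module B X]
      [IsScalarTower k B X] [FiniteDimensional k X],
      hh k B M X * q ≤ p * Module.finrank k X := fun X _ _ _ _ _ => ratio_all hmax _ X rfl
  have hpow : ∀ (X : Type) [AddCommGroup X] [Module k X] [Module B X]
      [IsScalarTower k B X] [FiniteDimensional k X] (n : ℕ),
      hh k B M X * q = p * Module.finrank k X →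
      hh k B M (Fin n → X) * q = p * Module.finrank k (Fin n → X) := by
    intro X _ _ _ _ _ n hX
    refine le_antisymm (hall _) ?_
    have h5 := Nat.mul_le_mul_right q (hh_pow (k := k) (B := B) (M := M) (X := X) n)
    rw [Module.finrank_pi_fintype]
    simp only [Finset.sum_const, Finset.card_univ, Fintype.card_fin, smul_eq_mul]
    calc _ = n * (p * Module.finrank k X) := by ring
      _ = n * hh k B M X * q := by rw [← hX]; ring
      _ ≤ _ := h5
  have hsub : ∀ (X Y : Type) [AddCommGroup X] [Module k X] [Module B X]
      [IsScalarTower k B X] [FiniteDimensional k X] [AddCommGroup Y] [Module k Y] [Module B Y]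
      [IsScalarTower k B Y] [FiniteDimensional k Y] (f : Y →ₗ[B] X), Function.Injective f →
      hh k B M X * q = p * Module.finrank k X → hh k B M Y * q = p * Module.finrank k Y := by
    intro X Y _ _ _ _ _ _ _ _ _ _ f hf hX
    have h := (InC_exact hall hX (LinearMap.range f)).1
    have : FiniteDimensional k (LinearMap.range f) := FiniteDimensional.of_injective
      (((LinearMap.range f).subtype).restrictScalars k) (Submodule.subtype_injective _)
    rwa [← hh_congr (LinearEquiv.ofInjective f hf),
      ← dim_congr (LinearEquiv.ofInjective f hf)] at h
  have hquo : ∀ (X Y : Type) [AddCommGroup X] [Module k X] [Module B X]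
      [IsScalarTower k B X] [FiniteDimensional k X] [AddCommGroup Y] [Module k Y] [Module B Y]
      [IsScalarTower k B Y] [FiniteDimensional k Y] (f : X →ₗ[B] Y), Function.Surjective f →
      hh k B M X * q = p * Module.finrank k X → hh k B M Y * q = p * Module.finrank k Y := by
    intro X Y _ _ _ _ _ _ _ _ _ _ f hf hX
    have h := (InC_exact hall hX (LinearMap.ker f)).2
    rwa [hh_congr (f.quotKerEquivOfSurjective hf),
      dim_congr (f.quotKerEquivOfSurjective hf)] at h
  have hTw : hh k B M (Tw ρ (B ⧸ I₀)) * q = p * Module.finrank k (Tw ρ (B ⧸ I₀)) := by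
    refine le_antisymm (hall _) ?_
    have h5 := Nat.mul_le_mul_right q (hh_tw ρ (B ⧸ I₀) C C' h1 h2)
    rw [dim_tw, ← hq]
    rw [← hp] at h5
    calc _ = v * p * q := by ring
      _ ≤ _ := h5
  have hB : hh k B M B * q = p * Module.finrank k B := by
    let u : Fin v → Tw ρ (B ⧸ I₀) := fun j => fun i => if i = j then I₀.mkQ 1 else 0
    refine hsub (Fin v → Tw ρ (B ⧸ I₀)) B (LinearMap.toSpanSingleton B _ u) ?_ (hpow _ _ hTw)
    rw [injective_iff_map_eq_zero]
    intro b hb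
    refine h3 I₀ hI₀ b fun i j => ?_
    have : ∑ l, ρ b i l • (if l = j then I₀.mkQ 1 else 0) = 0 :=
      congrFun (congrFun hb j) i
    simp only [smul_ite, smul_zero, Finset.sum_ite_eq', Finset.mem_univ, if_true] at this
    rw [← map_smul, smul_eq_mul, mul_one] at this
    simpa using this
  have hY : ∀ (Y : Type) [AddCommGroup Y] [Module k Y] [Module B Y]
      [IsScalarTower k B Y] [FiniteDimensional k Y],
      hh k B M Y * q = p * Module.finrank k Y := by
    intro Y _ _ _ _ _
    have : Module.Finite B Y := Module.Finite.of_restrictScalars_finite k B Y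
    obtain ⟨n, f, hf⟩ := Module.Finite.exists_fin' B Y
    exact hquo _ _ f hf (hpow B n hB)
  let _ : Module B k := Module.compHom k ε.toRingHom
  have hsm : ∀ (b : B) (x : k), b • x = ε b * x := fun _ _ => rfl
  have : IsScalarTower k B k := ⟨fun c b x => by
    rw [hsm, hsm, map_smul, smul_eq_mul, smul_eq_mul, mul_assoc]⟩
  have hk := hY k
  rw [Module.finrank_self, mul_one] at hk
  refine ⟨hh k B M k, fun Y _ _ _ _ _ => ?_⟩
  have := hY Y
  rw [← hk] at this
  exact Nat.eq_of_mul_eq_mul_right hqpos (by rw [this]; ring)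

lemma free_of_const (c : ℕ) (hc : ∀ (Y : Type) [AddCommGroup Y] [Module k Y] [Module B Y]
      [IsScalarTower k B Y] [FiniteDimensional k Y],
      hh k B M Y = c * Module.finrank k Y) : Module.Free B M := by
  have hd : c * Module.finrank k B ≤ Module.finrank k M := by
    have h := hh_bd (k := k) (B := B) (M := M)
    rw [hc] at h
    rwa [show Module.finrank k (BD k B) = Module.finrank k B from
      Subspace.dual_finrank_eq (K := k) (V := B)] at h
  have : Module.Finite B M := Module.Finite.of_restrictScalars_finite k B M
  let J := Module.jacobson B M
  have : FiniteDimensional k (M ⧸ J) := FiniteDimensional.of_surjective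
      ((J.mkQ).restrictScalars k) J.mkQ_surjective
  have : IsArtinian B (M ⧸ J) := isArtinian_of_tower k inferInstance
  have hss : IsSemisimpleModule B (M ⧸ J) :=
    (IsArtinian.isSemisimpleModule_iff_jacobson B (M ⧸ J)).2 (Module.jacobson_quotient_jacobson ..)
  let F := Fin c → B
  have hFfd : FiniteDimensional k F := inferInstanceAs (FiniteDimensional k (Fin c → B))
  let rk : (F →ₗ[B] M) → ℕ := fun f => Module.finrank k (LinearMap.range (J.mkQ ∘ₗ f))
  obtain ⟨f, hf⟩ : ∃ f, ∀ f', rk f' ≤ rk f := by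
    have hb : ∀ f, rk f ≤ Module.finrank k (M ⧸ J) := fun f =>
      Submodule.finrank_le ((LinearMap.range (J.mkQ ∘ₗ f)).restrictScalars k)
    have hfin : (Set.range rk).Finite := (Set.finite_Iic (Module.finrank k (M ⧸ J))).subset
      (by rintro _ ⟨f, rfl⟩; exact hb f)
    obtain ⟨_, ⟨f, rfl⟩, h⟩ := Set.exists_max_image (Set.range rk) _root_.id hfin ⟨_, 0, rfl⟩
    exact ⟨f, fun f' => h _ ⟨f', rfl⟩⟩
  have dimrk : ∀ g : F →ₗ[B] (M ⧸ J), Module.finrank k (LinearMap.range g) +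
      Module.finrank k (LinearMap.ker g) = Module.finrank k F := fun g =>
    LinearMap.finrank_range_add_finrank_ker (g.restrictScalars k)
  set g := J.mkQ ∘ₗ f with hg
  have hsurj : LinearMap.range g = ⊤ := by
    by_contra hne
    obtain ⟨K, hK⟩ := exists_isCompl (LinearMap.range g)
    have hKb : K ≠ ⊥ := by
      rintro rfl
      exact hne (by simpa using hK.sup_eq_top)
    have : FiniteDimensional k K := FiniteDimensional.of_injective
      ((K.subtype).restrictScalars k) K.subtype_injective
    let P : (M ⧸ J) →ₗ[B] K := Submodule.projectionOnto K (LinearMap.range g) hK.symm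
    let P' : (M ⧸ J) →ₗ[B] LinearMap.range g :=
      Submodule.projectionOnto (LinearMap.range g) K hK
    let pre : (M →ₗ[B] K) →ₗ[k] (F →ₗ[B] K) :=
      { toFun := fun φ => φ ∘ₗ f
        map_add' := fun _ _ => rfl
        map_smul' := fun _ _ => rfl }
    have hninj : ¬ Function.Injective pre := by
      intro hi
      have h0 : pre (P ∘ₗ J.mkQ) = pre 0 := by
        refine LinearMap.ext fun x => ?_
        change P (g x) = 0
        exact Submodule.projectionOnto_apply_of_mem_right hK.symm ⟨x, rfl⟩
      have h1 := hi h0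
      apply hKb
      rw [eq_bot_iff]
      intro x hx
      obtain ⟨m, rfl⟩ := J.mkQ_surjective x
      have := congrArg (fun t => t m) h1
      have h2 : P (J.mkQ m) = 0 := this
      have h3 : P ((⟨J.mkQ m, hx⟩ : K) : M ⧸ J) = ⟨J.mkQ m, hx⟩ :=
        Submodule.projectionOnto_apply_left _ _
      rw [h2] at h3
      exact (congrArg Subtype.val h3).symm
    have hdim : Module.finrank k (M →ₗ[B] K) = Module.finrank k (F →ₗ[B] K) := by
      have h1 : Module.finrank k (M →ₗ[B] K) = c * Module.finrank k K := hc K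
      have e : (Fin c → K) ≃ₗ[k] (F →ₗ[B] K) := (Pi.basisFun B (Fin c)).constr k
      rw [h1, ← e.finrank_eq, Module.finrank_pi_fintype]
      simp
    have hnsurj : ¬ Function.Surjective pre := fun hs => by
      have hfd1 : FiniteDimensional k (M →ₗ[B] K) := homFD
      have hfd2 : FiniteDimensional k (F →ₗ[B] K) := homFD
      exact hninj ((@LinearMap.injective_iff_surjective_of_finrank_eq_finrank k _ _ _ _ _ _ _ hfd1 hfd2 hdim pre).2 hs)
    obtain ⟨r, hr⟩ := not_forall.1 hnsurj
    have hker : ¬ (LinearMap.ker g ≤ LinearMap.ker r) := by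
      intro hle
      apply hr
      let r' : LinearMap.range g →ₗ[B] K :=
        ((LinearMap.ker g).liftQ r hle) ∘ₗ g.quotKerEquivRange.symm.toLinearMap
      refine ⟨r' ∘ₗ P' ∘ₗ J.mkQ, ?_⟩
      refine LinearMap.ext fun x => ?_
      change r' (P' (g x)) = r x
      have h1 : P' (g x) = ⟨g x, x, rfl⟩ :=
        Submodule.projectionOnto_apply_left hK (⟨g x, x, rfl⟩ : LinearMap.range g)
      have h2 : g.quotKerEquivRange.symm ⟨g x, x, rfl⟩ = (LinearMap.ker g).mkQ x := by
        rw [LinearEquiv.symm_apply_eq]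
        rfl
      rw [h1]
      simp only [r', LinearMap.comp_apply, LinearEquiv.coe_coe, h2]
      rfl
    obtain ⟨f', hf'⟩ := Module.projective_lifting_property J.mkQ (g + K.subtype ∘ₗ r)
      J.mkQ_surjective
    have hk1 : LinearMap.ker (g + K.subtype ∘ₗ r) < LinearMap.ker g := by
      have hle : LinearMap.ker (g + K.subtype ∘ₗ r) ≤ LinearMap.ker g ⊓ LinearMap.ker r := by
        intro x hx
        have hx' : g x + (r x : M ⧸ J) = 0 := hx
        have h1 : g x ∈ K := by
          rw [eq_neg_of_add_eq_zero_left hx']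
          exact K.neg_mem (r x).2
        have h2 : g x = 0 := (Submodule.disjoint_def.1 hK.disjoint) _ ⟨x, rfl⟩ h1
        rw [h2, zero_add] at hx'
        exact ⟨h2, Subtype.ext hx'⟩
      refine lt_of_le_of_ne (hle.trans inf_le_left) fun h => hker ?_
      rw [← h]
      exact hle.trans inf_le_right
    have h1 := dimrk g
    have h2 := dimrk (g + K.subtype ∘ₗ r)
    have h3 : Module.finrank k (LinearMap.range (J.mkQ ∘ₗ f')) ≤
      Module.finrank k (LinearMap.range g) := hf f'
    have h5 : Module.finrank k (LinearMap.range (J.mkQ ∘ₗ f')) =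
      Module.finrank k (LinearMap.range (g + K.subtype ∘ₗ r)) := by
      rw [← hf']
    rw [h5] at h3
    have h4 : Module.finrank k (LinearMap.ker (g + K.subtype ∘ₗ r)) <
        Module.finrank k (LinearMap.ker g) :=
      Submodule.finrank_lt_finrank_of_lt
        (s := (LinearMap.ker (g + K.subtype ∘ₗ r)).restrictScalars k)
        (t := (LinearMap.ker g).restrictScalars k) hk1
    omega
  have hfs : Function.Surjective f := by
    rw [← LinearMap.range_eq_top]
    by_contra hne
    obtain ⟨m, hm, hle⟩ := (eq_top_or_exists_le_coatom (LinearMap.range f)).resolve_left hne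
    have hJ : J ≤ m := sInf_le hm
    apply hm.1
    rw [eq_top_iff]
    intro x _
    have : J.mkQ x ∈ LinearMap.range g := by rw [hsurj]; trivial
    obtain ⟨y, hy⟩ := this
    have h1 : f y - x ∈ J := (Submodule.Quotient.eq J).1 hy
    have := m.sub_mem (hle ⟨y, rfl⟩) (hJ h1)
    simpa using this
  have hfi : Function.Injective f := by
    have hdF : Module.finrank k F = c * Module.finrank k B := by
      rw [Module.finrank_pi_fintype]; simp
    have h1 : Module.finrank k M ≤ Module.finrank k F :=
      LinearMap.finrank_le_finrank_of_surjective (f := f.restrictScalars k) hfs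
    exact (LinearMap.injective_iff_surjective_of_finrank_eq_finrank
      (f := f.restrictScalars k) (by omega)).2 hfs
  exact Module.Free.of_equiv (LinearEquiv.ofBijective f ⟨hfi, hfs⟩)

end main
end
end NZ

namespace NZ
noncomputable section
set_option linter.unusedSectionVars false

section comat
variable {k H : Type} [Field k] [AddCommGroup H] [Module k H] [Coalgebra k H]

/-- Slice map. -/
def slice (φ : H →ₗ[k] k) {X : Type} [AddCommGroup X] [Module k X] : X ⊗[k] H →ₗ[k] X :=
  (TensorProduct.rid k X).toLinearMap ∘ₗ φ.lTensor X

@[simp] lemma slice_tmul (φ : H →ₗ[k] k) {X : Type} [AddCommGroup X] [Module k X] (x : X) (h : H) :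
    slice φ (x ⊗ₜ[k] h) = φ h • x := by simp [slice]

/-- Left slice map. -/
def lslice (φ : H →ₗ[k] k) {X : Type} [AddCommGroup X] [Module k X] : H ⊗[k] X →ₗ[k] X :=
  (TensorProduct.lid k X).toLinearMap ∘ₗ φ.rTensor X

@[simp] lemma lslice_tmul (φ : H →ₗ[k] k) {X : Type} [AddCommGroup X] [Module k X] (x : X) (h : H) :
    lslice φ (h ⊗ₜ[k] x) = φ h • x := by simp [lslice]

lemma comul_slice (φ : H →ₗ[k] k) (x : H) : comul (R := k) (slice φ (comul x)) =
    (slice φ ∘ₗ comul (R := k) (A := H)).lTensor H (comul x) := by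
  have h1 : ∀ t : H ⊗[k] H, comul (R := k) (slice φ t) = slice φ (comul.rTensor H t) := by
    intro t
    induction t with
    | zero => simp
    | add a b ha hb => simp only [map_add, ha, hb]
    | tmul a b => simp
  have h2 : ∀ t : (H ⊗[k] H) ⊗[k] H, slice φ t =
      (slice φ).lTensor H (TensorProduct.assoc k H H H t) := by
    intro t
    induction t with
    | zero => simp
    | add a b ha hb => simp only [map_add, ha, hb]
    | tmul a b =>
      induction a with
      | zero => simp
      | add a c ha hb => simp only [map_add, ha, hb, TensorProduct.add_tmul]
      | tmul a c => simp
  rw [h1, h2, coassoc_apply, ← LinearMap.comp_apply, ← LinearMap.lTensor_comp]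

lemma slice_counit (x : H) : slice (counit (R := k)) (comul x) = x := by
  simp [slice]

lemma exists_fd_one (x : H) : ∃ V : Submodule k H, FiniteDimensional k V ∧ x ∈ V ∧
    ∀ y ∈ V, comul (R := k) y ∈ LinearMap.range (TensorProduct.map V.subtype (LinearMap.id (M := H))) := by
  classical
  let 𝓑 := Module.Basis.ofVectorSpace k H
  let T : Module.Dual k H →ₗ[k] H :=
    { toFun := fun φ => slice φ (comul x)
      map_add' := fun a b => by simp [slice, LinearMap.lTensor_add]
      map_smul' := fun a b => by simp [slice, LinearMap.lTensor_smul] }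
  let V := LinearMap.range T
  obtain ⟨b, hb⟩ : ∃ b : _ →₀ H, (b.sum fun i m => m ⊗ₜ[k] 𝓑 i) = comul x :=
    ⟨_, by rw [← TensorProduct.equivFinsuppOfBasisRight_symm_apply]; exact LinearEquiv.symm_apply_apply _ _⟩
  have hbV : ∀ i, b i ∈ V := by
    intro i
    refine ⟨𝓑.coord i, ?_⟩
    change slice (𝓑.coord i) (comul x) = b i
    rw [← hb, Finsupp.sum, map_sum]
    simp only [slice_tmul, Module.Basis.coord_apply, Module.Basis.repr_self, Finsupp.single_apply,
      ite_smul, one_smul, zero_smul]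
    simpa using fun h => h.symm
  refine ⟨V, ?_, ⟨counit, slice_counit x⟩, ?_⟩
  · have : V ≤ Submodule.span k (b '' b.support) := by
      rintro _ ⟨φ, rfl⟩
      change slice φ (comul x) ∈ _
      rw [← hb, Finsupp.sum, map_sum]
      refine Submodule.sum_mem _ fun i hi => ?_
      rw [slice_tmul]
      exact Submodule.smul_mem _ _ (Submodule.subset_span ⟨i, hi, rfl⟩)
    have hfd : FiniteDimensional k (Submodule.span k (b '' b.support)) :=
      FiniteDimensional.span_of_finite k (b.support.finite_toSet.image _)
    exact Submodule.finiteDimensional_of_le this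
  · rintro _ ⟨φ, rfl⟩
    change comul (slice φ (comul x)) ∈ _
    rw [comul_slice, ← hb, Finsupp.sum, map_sum]
    refine Submodule.sum_mem _ fun i hi => ?_
    exact ⟨(⟨b i, hbV i⟩ : V) ⊗ₜ (slice φ (comul (𝓑 i))), by simp⟩

lemma exists_fd (s : Finset H) : ∃ V : Submodule k H, FiniteDimensional k V ∧ (∀ x ∈ s, x ∈ V) ∧
    ∀ y ∈ V, comul (R := k) y ∈ LinearMap.range (TensorProduct.map V.subtype (LinearMap.id (M := H))) := by
  classical
  have mono : ∀ (V W : Submodule k H), V ≤ W →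
      LinearMap.range (TensorProduct.map V.subtype (LinearMap.id (R := k) (M := H))) ≤
      LinearMap.range (TensorProduct.map W.subtype (LinearMap.id (R := k) (M := H))) := by
    intro V W h
    have : TensorProduct.map V.subtype (LinearMap.id (R := k) (M := H)) =
      TensorProduct.map W.subtype (LinearMap.id (R := k) (M := H)) ∘ₗ
        TensorProduct.map (Submodule.inclusion h) LinearMap.id := by
      rw [← TensorProduct.map_comp]; rfl
    rw [this]
    exact LinearMap.range_comp_le_range _ _
  induction s using Finset.induction_on with
  | empty => exact ⟨⊥, inferInstance, by simp, by simpa using ⟨0, map_zero _⟩⟩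
  | insert a s _ ih =>
    obtain ⟨V, h1, h2, h3⟩ := ih
    obtain ⟨W, g1, g2, g3⟩ := exists_fd_one (k := k) a
    refine ⟨V ⊔ W, inferInstance, ?_, ?_⟩
    · intro x hx
      rcases Finset.mem_insert.1 hx with rfl | hx
      · exact Submodule.mem_sup_right g2
      · exact Submodule.mem_sup_left (h2 _ hx)
    · intro y hy
      obtain ⟨u, hu, w, hw, rfl⟩ := Submodule.mem_sup.1 hy
      rw [map_add]
      exact Submodule.add_mem _ (mono _ _ le_sup_left (h3 _ hu)) (mono _ _ le_sup_right (g3 _ hw))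

lemma exists_comatrix (s : Finset H) : ∃ (v : ℕ) (w : Fin v → H) (c : Fin v → Fin v → H),
    (∀ j, comul (R := k) (w j) = ∑ i, w i ⊗ₜ[k] c i j) ∧
    (∀ i j, comul (R := k) (c i j) = ∑ l, c i l ⊗ₜ[k] c l j) ∧
    (∀ i j, counit (R := k) (c i j) = if i = j then 1 else 0) ∧
    (∀ j, ∑ i, counit (R := k) (w i) • c i j = w j) ∧
    (∀ x ∈ s, x ∈ Submodule.span k (Set.range w)) := by
  obtain ⟨V, hV, hs, hcV⟩ := exists_fd (k := k) s
  let v := Module.finrank k V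
  let wb : Module.Basis (Fin v) k V := Module.finBasis k V
  let w : Fin v → H := fun i => wb i
  have hc : ∀ j, ∃ c : Fin v → H, comul (R := k) (w j) = ∑ i, w i ⊗ₜ[k] c i := by
    intro j
    obtain ⟨t, ht⟩ := hcV (w j) (wb j).2
    refine ⟨TensorProduct.equivFinsuppOfBasisLeft wb t, ?_⟩
    obtain ⟨b, rfl⟩ := (TensorProduct.equivFinsuppOfBasisLeft wb).symm.surjective t
    rw [LinearEquiv.apply_symm_apply, ← ht, TensorProduct.equivFinsuppOfBasisLeft_symm_apply,
      Finsupp.sum_fintype _ _ (by simp), map_sum]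
    rfl
  choose c' hc' using hc
  let c : Fin v → Fin v → H := fun i j => c' j i
  have hw : ∀ j, comul (R := k) (w j) = ∑ i, w i ⊗ₜ[k] c i j := hc'
  have hφ : ∀ l, ∃ φ : H →ₗ[k] k, ∀ m, φ (w m) = if m = l then 1 else 0 := by
    intro l
    obtain ⟨φ, hφ⟩ := LinearMap.exists_extend (wb.coord l)
    refine ⟨φ, fun m => ?_⟩
    have := congrArg (fun t => t (wb m)) hφ
    simpa [Finsupp.single_apply, w] using this
  choose φ hφ using hφ
  refine ⟨v, w, c, hw, ?_, ?_, ?_, ?_⟩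
  · intro i j
    have h := coassoc_apply (R := k) (w j)
    simp only [hw, map_sum, LinearMap.rTensor_tmul, LinearMap.lTensor_tmul,
      TensorProduct.sum_tmul, TensorProduct.assoc_tmul] at h
    have h2 := congrArg (lslice (φ i)) h
    simp only [map_sum, lslice_tmul, hφ, ite_smul, one_smul, zero_smul, Finset.sum_ite_eq',
      Finset.mem_univ, if_true] at h2
    exact h2.symm
  · intro i j
    have h := lTensor_counit_comul (R := k) (w j)
    rw [hw, map_sum] at h
    have h2 := congrArg (lslice (φ i)) h
    simp only [map_sum, LinearMap.lTensor_tmul, lslice_tmul, hφ, ite_smul, one_smul, zero_smul,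
      Finset.sum_ite_eq', Finset.mem_univ, if_true] at h2
    rw [h2]
    simp [eq_comm]
  · intro j
    have h := rTensor_counit_comul (R := k) (w j)
    rw [hw, map_sum] at h
    have h2 := congrArg (TensorProduct.lid k H) h
    simpa using h2
  · intro x hx
    have h := wb.mem_span ⟨x, hs x hx⟩
    have h2 := Submodule.mem_map_of_mem (f := V.subtype) h
    rw [Submodule.map_span] at h2
    rw [← Set.range_comp] at h2
    exact h2

end comat
end
end NZ

namespace NZ
noncomputable section
set_option linter.unusedSectionVars false

open WithConv Paper

section convs
variable {k : Type} [Field k]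

abbrev Bd (k C : Type) [Field k] [AddCommGroup C] [Module k C] : Type := WithConv (C →ₗ[k] k)

instance Bd.fd {C : Type} [AddCommGroup C] [Module k C] [FiniteDimensional k C] :
    FiniteDimensional k (Bd k C) :=
  Module.Finite.equiv (WithConv.linearEquiv k (C →ₗ[k] k)).symm

lemma conv_eq {C : Type} [AddCommGroup C] [Module k C] [Coalgebra k C] (f g : Module.Dual k C) :
    conv k f g = (toConv f * toConv g : Bd k C).ofConv := by
  ext x
  rw [LinearMap.convMul_def]
  simp only [conv, LinearMap.comp_apply]
  generalize TensorProduct.map f g (comul x) = t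
  rw [LinearEquiv.coe_coe]
  induction t with
  | zero => simp
  | add a b ha hb => simp only [map_add, ha, hb]
  | tmul a b => simp

lemma ofConv_mul {C : Type} [AddCommGroup C] [Module k C] [Coalgebra k C] (f g : Bd k C) :
    (f * g).ofConv = conv k f.ofConv g.ofConv := by
  rw [conv_eq]

lemma conv_apply {C : Type} [AddCommGroup C] [Module k C] [Coalgebra k C] (f g : Module.Dual k C)
    (x : C) {n : ℕ} (a b : Fin n → C) (h : comul (R := k) x = ∑ i, a i ⊗ₜ[k] b i) :
    conv k f g x = ∑ i, f (a i) * g (b i) := by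
  simp [conv, h]

lemma exists_repr {C : Type} [AddCommGroup C] [Module k C] [Coalgebra k C] (x : C) :
    ∃ (n : ℕ) (a b : Fin n → C), comul (R := k) x = ∑ i, a i ⊗ₜ[k] b i := by
  obtain ⟨n, a, b, h⟩ := TensorProduct.exists_sum_tmul_eq (comul (R := k) x)
  exact ⟨n, a, b, h⟩

variable {H : Type} [Ring H] [Bialgebra k H]

lemma conv_mulLeft (f g : Module.Dual k H) (h : H) {n : ℕ} (a b : Fin n → H)
    (hh : comul (R := k) h = ∑ i, a i ⊗ₜ[k] b i) :
    (conv k f g) ∘ₗ LinearMap.mulLeft k h =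
      ∑ i, conv k (f ∘ₗ LinearMap.mulLeft k (a i)) (g ∘ₗ LinearMap.mulLeft k (b i)) := by
  ext x
  simp only [conv, LinearMap.comp_apply, LinearMap.mulLeft_apply, Bialgebra.comul_mul, hh,
    Finset.sum_mul, map_sum, LinearMap.sum_apply]
  refine Finset.sum_congr rfl fun i _ => ?_
  generalize comul (R := k) x = t
  induction t with
  | zero => simp
  | add a b ha hb => simp only [map_add, ha, hb, mul_add]
  | tmul a b => simp

/-- The action of `H` on its dual. -/
def dact : Bd k H →ₗ[k] H →ₗ[k] Bd k H :=
  LinearMap.mk₂ k (fun β y => toConv (β.ofConv ∘ₗ LinearMap.mulLeft k y))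
    (fun _ _ _ => rfl) (fun _ _ _ => rfl)
    (fun β y z => by
      apply WithConv.ofConv_injective
      ext x
      simp [add_mul])
    (fun c β y => by
      apply WithConv.ofConv_injective
      ext x
      simp)

lemma dact_apply (β : Bd k H) (y z : H) : (dact β y).ofConv z = β.ofConv (y * z) := rfl

lemma dact_mul (β γ : Bd k H) (h : H) {n : ℕ} (a b : Fin n → H)
    (hh : comul (R := k) h = ∑ i, a i ⊗ₜ[k] b i) :
    dact (β * γ) h = ∑ i, dact β (a i) * dact γ (b i) := by
  apply WithConv.ofConv_injective
  have : (∑ i, dact β (a i) * dact γ (b i)).ofConv = ∑ i, (dact β (a i) * dact γ (b i)).ofConv :=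
    map_sum (WithConv.linearEquiv k (H →ₗ[k] k)) _ _
  rw [this]
  simp only [ofConv_mul]
  have h2 := conv_mulLeft β.ofConv γ.ofConv h a b hh
  rw [← ofConv_mul] at h2
  exact h2

lemma one_apply' {C : Type} [AddCommGroup C] [Module k C] [Coalgebra k C] (x : C) :
    (1 : Bd k C).ofConv x = counit (R := k) x := by
  simp [LinearMap.convOne_def]

/-- The augmentation of the dual. -/
def augB : Bd k H →ₐ[k] k :=
  AlgHom.ofLinearMap
    { toFun := fun β => β.ofConv 1
      map_add' := fun _ _ => rfl
      map_smul' := fun _ _ => rfl }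
    (by
      change (1 : Bd k H).ofConv 1 = 1
      rw [one_apply', Bialgebra.counit_one])
    (fun β γ => by
      change (β * γ).ofConv 1 = β.ofConv 1 * γ.ofConv 1
      rw [ofConv_mul]
      simp [conv, Bialgebra.comul_one, Algebra.TensorProduct.one_def])

end convs

section hm
variable {k : Type} [Field k] {H : Type} [Ring H] [HopfAlgebra k H]
  {Hb : Type} [Ring Hb] [HopfAlgebra k Hb]

structure HopfMod (π : H →ₗ[k] Hb) (M : Type) [AddCommGroup M] [Module k M] [Module (Bd k Hb) M] where
  act : H →ₗ[k] M →ₗ[k] M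
  act_one : ∀ m, act 1 m = m
  act_mul : ∀ h h' m, act (h * h') m = act h' (act h m)
  compat : ∀ (h : H) (n : ℕ) (a b : Fin n → H), comul (R := k) h = ∑ i, a i ⊗ₜ[k] b i →
    ∀ (β : Bd k Hb) m, act h (β • m) = ∑ i, dact β (π (a i)) • act (b i) m

structure IsPi (π : H →ₗ[k] Hb) : Prop where
  surj : Function.Surjective π
  one : π 1 = 1
  mul : ∀ x y : H, π (x * y) = π x * π y
  com : ∀ x : H, comul (R := k) (π x) = TensorProduct.map π π (comul x)
  cou : ∀ x : H, counit (R := k) (π x) = counit (R := k) x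

variable {π : H →ₗ[k] Hb} (hπ : IsPi π)

lemma key_ideal [FiniteDimensional k Hb] (I : Submodule (Bd k Hb) (Bd k Hb)) (hI : I ≠ ⊤)
    (β : Bd k Hb) (h : ∀ y, dact β y ∈ I) : β = 0 := by
  let b := Module.finBasis k Hb
  have key : ∀ y, ∑ i, (toConv ((b.coord i) ∘ₗ HopfAlgebra.antipode (R := k)) : Bd k Hb) *
      dact β (y * b i) = β.ofConv y • 1 := by
    intro y
    apply WithConv.ofConv_injective
    have : ∀ F : Fin (Module.finrank k Hb) → Bd k Hb, (∑ i, F i).ofConv = ∑ i, (F i).ofConv :=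
      fun F => map_sum (WithConv.linearEquiv k (Hb →ₗ[k] k)) _ _
    rw [this]
    ext z
    obtain ⟨n, p, q, hz⟩ := exists_repr (k := k) z
    have h1 := HopfAlgebra.mul_antipode_rTensor_comul_apply (R := k) z
    rw [hz] at h1
    simp only [map_sum, LinearMap.rTensor_tmul, LinearMap.mul'_apply] at h1
    simp only [LinearMap.sum_apply, ofConv_mul, conv_apply _ _ z p q hz]
    rw [Finset.sum_comm]
    change _ = β.ofConv y * (1 : Bd k Hb).ofConv z
    rw [one_apply']
    calc _ = ∑ j, β.ofConv (y * (HopfAlgebra.antipode (R := k) (p j)) * q j) := by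
          refine Finset.sum_congr rfl fun j _ => ?_
          conv_rhs => rw [← b.sum_repr (HopfAlgebra.antipode (R := k) (p j))]
          simp only [Finset.mul_sum, Finset.sum_mul, map_sum]
          refine Finset.sum_congr rfl fun i _ => ?_
          simp [dact_apply]
      _ = β.ofConv (y * ∑ j, (HopfAlgebra.antipode (R := k) (p j)) * q j) := by
          simp only [Finset.mul_sum, map_sum, mul_assoc]
      _ = _ := by
          rw [h1, Algebra.algebraMap_eq_smul_one, mul_smul_comm, mul_one, map_smul, smul_eq_mul,
            mul_comm]
  apply WithConv.ofConv_injective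
  ext y
  by_contra hy
  have hy : β.ofConv y ≠ 0 := hy
  apply hI
  rw [eq_top_iff]
  intro γ _
  have h1 : β.ofConv y • (1 : Bd k Hb) ∈ I := by
    rw [← key y]
    exact Submodule.sum_mem _ fun i _ => I.smul_mem _ (h _)
  have h2 := I.smul_mem ((β.ofConv y)⁻¹ • γ) h1
  rw [smul_eq_mul, smul_mul_smul_comm, inv_mul_cancel₀ hy, one_smul, mul_one] at h2
  exact h2

lemma HopfMod.free_fd (hπ : IsPi π) [FiniteDimensional k Hb] {M : Type} [AddCommGroup M] [Module k M]
    [Module (Bd k Hb) M] [IsScalarTower k (Bd k Hb) M] [FiniteDimensional k M]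
    (hm : HopfMod π M) : Module.Free (Bd k Hb) M := by
  classical
  obtain ⟨s, hs⟩ := (inferInstance : Module.Finite k Hb)
  choose g hg using hπ.surj
  obtain ⟨v, w, c, hw, hc, hε, hwc, hsp⟩ := exists_comatrix (k := k) (s.image g)
  have hπc : ∀ i j, comul (R := k) (π (c i j)) = ∑ l, π (c i l) ⊗ₜ[k] π (c l j) := by
    intro i j
    rw [hπ.com, hc, map_sum]
    simp
  let ρ : Bd k Hb →ₐ[k] Matrix (Fin v) (Fin v) (Bd k Hb) := AlgHom.ofLinearMap
    { toFun := fun β => Matrix.of fun i j => dact β (π (c i j))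
      map_add' := fun a b => by ext1 i j; simp
      map_smul' := fun a b => by ext1 i j; simp }
    (by
      ext1 i j
      change dact 1 (π (c i j)) = _
      apply WithConv.ofConv_injective
      ext z
      rw [dact_apply, one_apply', Bialgebra.counit_mul, hπ.cou, hε, Matrix.one_apply]
      split_ifs
      · rw [one_mul, one_apply']
      · rw [zero_mul]; rfl)
    (fun β γ => by
      ext1 i j
      rw [Matrix.mul_apply]
      exact dact_mul β γ _ _ _ (hπc i j))
  have hρ : ∀ β i j, ρ β i j = dact β (π (c i j)) := fun _ _ _ => rfl
  obtain ⟨d, hd⟩ := hh_const (M := M) ρ (fun i j => hm.act (c i j))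
    (fun i j => hm.act (HopfAlgebra.antipode (R := k) (c i j)))
    (fun i j β m => hm.compat _ _ _ _ (hc i j) β m)
    (fun j p m => by
      simp only [← hm.act_mul]
      have h1 := HopfAlgebra.mul_antipode_rTensor_comul_apply (R := k) (c p j)
      rw [hc, hε] at h1
      simp only [map_sum, LinearMap.rTensor_tmul, LinearMap.mul'_apply] at h1
      rw [← LinearMap.sum_apply, ← map_sum, h1]
      split_ifs
      · rw [map_one, hm.act_one]
      · simp)
    (fun I hI β hβ => by
      refine key_ideal I hI β fun y => ?_
      have h1 : ∀ j, dact β (π (w j)) ∈ I := by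
        intro j
        rw [← hwc j]
        simp only [map_sum, map_smul]
        refine Submodule.sum_mem _ fun i _ => ?_
        exact (I.restrictScalars k).smul_mem _ (hβ i j)
      have h2 : ∀ x ∈ Submodule.span k (Set.range w), dact β (π x) ∈ I := by
        intro x hx
        have : Submodule.span k (Set.range w) ≤
            (I.restrictScalars k).comap ((dact β) ∘ₗ π) := by
          rw [Submodule.span_le]
          rintro _ ⟨j, rfl⟩
          exact h1 j
        exact this hx
      have h3 : (⊤ : Submodule k Hb) ≤ (I.restrictScalars k).comap (dact β) := by
        rw [← hs, Submodule.span_le]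
        intro z hz
        have := h2 (g z) (hsp _ (Finset.mem_image_of_mem g hz))
        rw [hg] at this
        exact this
      exact h3 (Submodule.mem_top (x := y)))
    augB
  exact free_of_const d hd

end hm

end
end NZ

namespace NZ
noncomputable section
set_option linter.unusedSectionVars false

open WithConv Paper

section zorn
variable {k : Type} [Field k] {H : Type} [Ring H] [HopfAlgebra k H]
  {Hb : Type} [Ring Hb] [HopfAlgebra k Hb] {π : H →ₗ[k] Hb}
  {M : Type} [AddCommGroup M] [Module k M] [Module (Bd k Hb) M] [IsScalarTower k (Bd k Hb) M]

def HopfMod.sub (hm : HopfMod π M) (F : Submodule (Bd k Hb) M)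
    (hF : ∀ h, ∀ x ∈ F, hm.act h x ∈ F) : HopfMod π F where
  act := LinearMap.mk₂ k (fun h x => ⟨hm.act h x, hF h x x.2⟩)
    (fun _ _ _ => Subtype.ext (by simp))
    (fun _ _ _ => Subtype.ext (by simp))
    (fun _ _ _ => Subtype.ext (by simp))
    (fun _ _ _ => Subtype.ext (by simp))
  act_one m := Subtype.ext (hm.act_one m)
  act_mul h h' m := Subtype.ext (hm.act_mul h h' m)
  compat h n a b hab β m := Subtype.ext (by
    have := hm.compat h n a b hab β m
    simpa using this)

def HopfMod.actQ (hm : HopfMod π M) (N : Submodule (Bd k Hb) M)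
    (hN : ∀ h, ∀ x ∈ N, hm.act h x ∈ N) (h : H) : (M ⧸ N) →ₗ[k] (M ⧸ N) :=
  (Submodule.Quotient.restrictScalarsEquiv k N).toLinearMap ∘ₗ
    Submodule.mapQ (N.restrictScalars k) (N.restrictScalars k) (hm.act h) (fun x hx => hN h x hx) ∘ₗ
    (Submodule.Quotient.restrictScalarsEquiv k N).symm.toLinearMap

lemma HopfMod.actQ_mk (hm : HopfMod π M) (N : Submodule (Bd k Hb) M)
    (hN : ∀ h, ∀ x ∈ N, hm.act h x ∈ N) (h : H) (m : M) :
    hm.actQ N hN h (N.mkQ m) = N.mkQ (hm.act h m) := rfl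

def HopfMod.actQL (hm : HopfMod π M) (N : Submodule (Bd k Hb) M)
    (hN : ∀ h, ∀ x ∈ N, hm.act h x ∈ N) : H →ₗ[k] (M ⧸ N) →ₗ[k] (M ⧸ N) where
  toFun := hm.actQ N hN
  map_add' a b := by
    refine LinearMap.ext fun x => ?_
    obtain ⟨m, rfl⟩ := N.mkQ_surjective x
    rw [LinearMap.add_apply, hm.actQ_mk, hm.actQ_mk, hm.actQ_mk, ← map_add, map_add hm.act,
      LinearMap.add_apply]
  map_smul' a b := by
    refine LinearMap.ext fun x => ?_
    obtain ⟨m, rfl⟩ := N.mkQ_surjective x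
    rw [RingHom.id_apply, LinearMap.smul_apply, hm.actQ_mk, hm.actQ_mk, map_smul hm.act,
      LinearMap.smul_apply]
    rfl

lemma HopfMod.actQL_mk (hm : HopfMod π M) (N : Submodule (Bd k Hb) M)
    (hN : ∀ h, ∀ x ∈ N, hm.act h x ∈ N) (h : H) (m : M) :
    hm.actQL N hN h (N.mkQ m) = N.mkQ (hm.act h m) := rfl

def HopfMod.quo (hm : HopfMod π M) (N : Submodule (Bd k Hb) M)
    (hN : ∀ h, ∀ x ∈ N, hm.act h x ∈ N) : HopfMod π (M ⧸ N) where
  act := hm.actQL N hN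
  act_one x := by
    obtain ⟨m, rfl⟩ := N.mkQ_surjective x
    rw [hm.actQL_mk, hm.act_one]
  act_mul h h' x := by
    obtain ⟨m, rfl⟩ := N.mkQ_surjective x
    rw [hm.actQL_mk, hm.actQL_mk, hm.actQL_mk, hm.act_mul]
  compat h n a b hab β x := by
    obtain ⟨m, rfl⟩ := N.mkQ_surjective x
    rw [← map_smul, hm.actQL_mk, hm.compat h n a b hab β m, map_sum]
    refine Finset.sum_congr rfl fun i _ => ?_
    rw [map_smul, hm.actQL_mk]

lemma HopfMod.span_stable (hm : HopfMod π M) (s : Set M)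
    (hs : ∀ h, ∀ x ∈ s, hm.act h x ∈ Submodule.span (Bd k Hb) s) :
    ∀ h, ∀ x ∈ Submodule.span (Bd k Hb) s, hm.act h x ∈ Submodule.span (Bd k Hb) s := by
  intro h x hx
  induction hx using Submodule.span_induction generalizing h with
  | mem x hx => exact hs h x hx
  | zero => simp
  | add x y _ _ h1 h2 => rw [map_add]; exact Submodule.add_mem _ (h1 h) (h2 h)
  | smul β x _ h1 =>
    obtain ⟨n, a, b, hab⟩ := exists_repr (k := k) h
    rw [hm.compat h n a b hab]
    exact Submodule.sum_mem _ fun i _ => Submodule.smul_mem _ _ (h1 _)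

lemma HopfMod.free (hπ : IsPi π) [FiniteDimensional k Hb] (hm : HopfMod π M)
    (hloc : ∀ m, ∃ F : Submodule (Bd k Hb) M, m ∈ F ∧ FiniteDimensional k F ∧
      ∀ h, ∀ x ∈ F, hm.act h x ∈ F) : Module.Free (Bd k Hb) M := by
  let S : Set (Set M) := {s | LinearIndepOn (Bd k Hb) _root_.id s ∧
    ∀ h, ∀ x ∈ s, hm.act h x ∈ Submodule.span (Bd k Hb) s}
  obtain ⟨s, hs⟩ := zorn_subset S (by
    intro c hc hch
    refine ⟨⋃₀ c, ⟨?_, ?_⟩, fun t ht => Set.subset_sUnion_of_mem ht⟩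
    · exact linearIndepOn_sUnion_of_directed hch.directedOn fun t ht => (hc ht).1
    · rintro h x ⟨t, ht, hx⟩
      exact Submodule.span_mono (Set.subset_sUnion_of_mem ht) ((hc ht).2 h x hx))
  have hsS : s ∈ S := hs.prop
  set N := Submodule.span (Bd k Hb) s with hN
  have hNst := hm.span_stable s hsS.2
  have htop : N = ⊤ := by
    by_contra hne
    obtain ⟨m, hm'⟩ : ∃ m, m ∉ N := by
      by_contra! h
      exact hne (eq_top_iff.2 fun x _ => h x)
    obtain ⟨F, hmF, hFfd, hFst⟩ := hloc m
    let G : Submodule (Bd k Hb) (M ⧸ N) := F.map N.mkQ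
    have hGst : ∀ h, ∀ x ∈ G, (hm.quo N hNst).act h x ∈ G := by
      rintro h _ ⟨x, hx, rfl⟩
      exact ⟨hm.act h x, hFst h x hx, rfl⟩
    have hGfd : FiniteDimensional k G := by
      let f : F →ₗ[Bd k Hb] G := N.mkQ.restrict (p := F) (q := G) (fun x hx => ⟨x, hx, rfl⟩)
      have hf : Function.Surjective (f.restrictScalars k) := by
        rintro ⟨_, x, hx, rfl⟩
        exact ⟨⟨x, hx⟩, rfl⟩
      exact Module.Finite.of_surjective (f.restrictScalars k) hf
    have hfree : Module.Free (Bd k Hb) G := ((hm.quo N hNst).sub G hGst).free_fd hπ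
    let b := Module.Free.chooseBasis (Bd k Hb) G
    have hu : ∀ i, ∃ u ∈ F, N.mkQ u = b i := fun i => (b i).2
    choose u huF hub using hu
    have hspan : Submodule.span (Bd k Hb) (s ∪ Set.range u) = N ⊔ F := by
      rw [Submodule.span_union]
      apply le_antisymm
      · refine sup_le_sup le_rfl ?_
        rw [Submodule.span_le]
        rintro _ ⟨i, rfl⟩
        exact huF i
      · refine sup_le le_sup_left fun x hx => ?_
        have h1 : (⟨N.mkQ x, x, hx, rfl⟩ : G) ∈ Submodule.span (Bd k Hb) (Set.range b) := b.mem_span _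
        have h2 := Submodule.mem_map_of_mem (f := G.subtype) h1
        rw [Submodule.map_span, ← Set.range_comp] at h2
        have h3 : (G.subtype ∘ b) = N.mkQ ∘ u := by
          funext i; exact (hub i).symm
        rw [h3, Set.range_comp, ← Submodule.map_span] at h2
        obtain ⟨y, hy, hyx⟩ := h2
        have h4 : y - x ∈ N := (Submodule.Quotient.eq N).1 hyx
        have : x = -(y - x) + y := by abel
        rw [this]
        exact Submodule.add_mem _ (Submodule.mem_sup_left (N.neg_mem h4)) (Submodule.mem_sup_right hy)
    have hmem : s ∪ Set.range u ∈ S := by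
      constructor
      · have h1 : LinearIndependent (Bd k Hb) (fun x : s => (⟨x, Submodule.subset_span x.2⟩ : N)) := by
          refine LinearIndependent.of_comp N.subtype ?_
          exact hsS.1
        have h2 := h1.sumElim_of_quotient u (by
          have : (Submodule.Quotient.mk (p := N) ∘ u) = G.subtype ∘ b := by
            funext i; exact hub i
          rw [this]
          exact b.linearIndependent.map' G.subtype G.ker_subtype)
        refine h2.linearIndepOn_id' ?_
        rw [Set.Sum.elim_range]
        simp
      · rintro h x hx
        rw [hspan]
        have hx' : x ∈ N ⊔ F := by rw [← hspan]; exact Submodule.subset_span hx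
        obtain ⟨y, hy, z, hz, rfl⟩ := Submodule.mem_sup.1 hx'
        rw [map_add]
        exact Submodule.add_mem _ (Submodule.mem_sup_left (hNst h y hy))
          (Submodule.mem_sup_right (hFst h z hz))
    have hle : s ∪ Set.range u ⊆ s := hs.le_of_ge hmem Set.subset_union_left
    apply hm'
    have h1 : m ∈ Submodule.span (Bd k Hb) (s ∪ Set.range u) := by
      rw [hspan]; exact Submodule.mem_sup_right hmF
    exact Submodule.span_mono hle h1
  have hli : LinearIndependent (Bd k Hb) (fun x : s => (x : M)) := hsS.1
  exact Module.Free.of_basis (Module.Basis.mk hli (by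
    rw [Subtype.range_coe]; exact htop.ge))

end zorn
end
end NZ

namespace NZ
noncomputable section
set_option linter.unusedSectionVars false

open WithConv Paper

section findual
variable {k : Type} [Field k] {H : Type} [Ring H] [Bialgebra k H]

lemma map_mulL (I J : Submodule k H)
    (hI : ∀ (h : H), ∀ x ∈ I, h * x ∈ I ∧ x * h ∈ I)
    (hJ : ∀ (h : H), ∀ x ∈ J, h * x ∈ J ∧ x * h ∈ J) (s t : H ⊗[k] H)
    (ht : TensorProduct.map I.mkQ J.mkQ t = 0) :
    TensorProduct.map I.mkQ J.mkQ (s * t) = 0 ∧ TensorProduct.map I.mkQ J.mkQ (t * s) = 0 := by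
  induction s with
  | zero => simp
  | add x y hx hy => rw [add_mul, mul_add, map_add, map_add, hx.1, hy.1, hx.2, hy.2]; simp
  | tmul a b =>
    have h1 : ∀ t : H ⊗[k] H, TensorProduct.map I.mkQ J.mkQ (a ⊗ₜ b * t) =
        TensorProduct.map (I.mapQ I (LinearMap.mulLeft k a) (fun x hx => (hI a x hx).1))
          (J.mapQ J (LinearMap.mulLeft k b) (fun x hx => (hJ b x hx).1))
          (TensorProduct.map I.mkQ J.mkQ t) := by
      intro t
      induction t with
      | zero => simp
      | add x y hx hy => rw [mul_add, map_add, hx, hy, map_add, map_add]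
      | tmul c d =>
        rw [Algebra.TensorProduct.tmul_mul_tmul, TensorProduct.map_tmul, TensorProduct.map_tmul,
          TensorProduct.map_tmul]
        rfl
    have h2 : ∀ t : H ⊗[k] H, TensorProduct.map I.mkQ J.mkQ (t * a ⊗ₜ b) =
        TensorProduct.map (I.mapQ I (LinearMap.mulRight k a) (fun x hx => (hI a x hx).2))
          (J.mapQ J (LinearMap.mulRight k b) (fun x hx => (hJ b x hx).2))
          (TensorProduct.map I.mkQ J.mkQ t) := by
      intro t
      induction t with
      | zero => simp
      | add x y hx hy => rw [add_mul, map_add, hx, hy, map_add, map_add]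
      | tmul c d =>
        rw [Algebra.TensorProduct.tmul_mul_tmul, TensorProduct.map_tmul, TensorProduct.map_tmul,
          TensorProduct.map_tmul]
        rfl
    rw [h1, h2, ht, map_zero, map_zero]
    exact ⟨rfl, rfl⟩

lemma finDual_conv {f g : Module.Dual k H} (hf : f ∈ finDual k H) (hg : g ∈ finDual k H) :
    conv k f g ∈ finDual k H := by
  obtain ⟨I, hI, hIf, hIfd⟩ := hf
  obtain ⟨J, hJ, hJg, hJfd⟩ := hg
  let φ : H →ₗ[k] (H ⧸ I) ⊗[k] (H ⧸ J) := TensorProduct.map I.mkQ J.mkQ ∘ₗ comul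
  refine ⟨LinearMap.ker φ, ?_, ?_, ?_⟩
  · intro h x hx
    have hx' : TensorProduct.map I.mkQ J.mkQ (comul (R := k) x) = 0 := hx
    have := map_mulL I J hI hJ (comul h) _ hx'
    rw [← Bialgebra.comul_mul, ← Bialgebra.comul_mul] at this
    exact this
  · intro x hx
    have hx' : TensorProduct.map I.mkQ J.mkQ (comul (R := k) x) = 0 := hx
    have h1 : TensorProduct.map f g = TensorProduct.map (I.liftQ f hIf) (J.liftQ g hJg) ∘ₗ
        TensorProduct.map I.mkQ J.mkQ := by
      rw [← TensorProduct.map_comp, Submodule.liftQ_mkQ, Submodule.liftQ_mkQ]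
    rw [LinearMap.mem_ker, conv, LinearMap.comp_apply, LinearMap.comp_apply, h1,
      LinearMap.comp_apply, hx', map_zero, map_zero]
  · exact Module.Finite.equiv φ.quotKerEquivRange.symm

lemma finDual_add {f g : Module.Dual k H} (hf : f ∈ finDual k H) (hg : g ∈ finDual k H) :
    f + g ∈ finDual k H := by
  obtain ⟨I, hI, hIf, hIfd⟩ := hf
  obtain ⟨J, hJ, hJg, hJfd⟩ := hg
  let φ : H →ₗ[k] (H ⧸ I) × (H ⧸ J) := I.mkQ.prod J.mkQ
  have hk : LinearMap.ker φ = I ⊓ J := by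
    rw [LinearMap.ker_prod, Submodule.ker_mkQ, Submodule.ker_mkQ]
  have h3 : FiniteDimensional k (H ⧸ LinearMap.ker φ) :=
    Module.Finite.equiv φ.quotKerEquivRange.symm
  rw [hk] at h3
  refine ⟨I ⊓ J, fun h x hx => ⟨⟨(hI h x hx.1).1, (hJ h x hx.2).1⟩,
    ⟨(hI h x hx.1).2, (hJ h x hx.2).2⟩⟩, fun x hx => ?_, h3⟩
  rw [LinearMap.mem_ker, LinearMap.add_apply, LinearMap.mem_ker.1 (hIf hx.1),
    LinearMap.mem_ker.1 (hJg hx.2), add_zero]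

lemma finDual_zero : (0 : Module.Dual k H) ∈ finDual k H := by
  refine ⟨⊤, by simp, by simp, ?_⟩
  exact Module.Finite.of_finite

lemma finDual_pi {Hb : Type} [Ring Hb] [HopfAlgebra k Hb] [FiniteDimensional k Hb]
    (π : H →ₗ[k] Hb) (hmul : ∀ x y : H, π (x * y) = π x * π y) (β : Module.Dual k Hb) :
    β ∘ₗ π ∈ finDual k H := by
  refine ⟨LinearMap.ker π, fun h x hx => ?_, fun x hx => ?_, ?_⟩
  · rw [LinearMap.mem_ker] at hx
    simp [hmul, hx]
  · rw [LinearMap.mem_ker] at hx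
    simp [hx]
  · exact Module.Finite.equiv π.quotKerEquivRange.symm

end findual

section spanfd
lemma span_fd {k B M : Type} [Field k] [Ring B] [Algebra k B] [FiniteDimensional k B]
    [AddCommGroup M] [Module k M] [Module B M] [IsScalarTower k B M] (W : Set M)
    (R : Submodule k M) [FiniteDimensional k R] (hW : W ⊆ R) :
    FiniteDimensional k (Submodule.span B W) := by
  have hfg : R.FG := Module.Finite.iff_fg.1 inferInstance
  obtain ⟨t, ht⟩ := hfg
  have hsp : Submodule.span B W ≤ Submodule.span B (t : Set M) := by
    rw [Submodule.span_le]
    intro g hg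
    have h1 := hW hg
    rw [← ht] at h1
    exact Submodule.span_subset_span k B _ h1
  have h2 : Module.Finite B (Submodule.span B (t : Set M)) :=
    Module.Finite.span_of_finite _ t.finite_toSet
  have h3 : FiniteDimensional k (Submodule.span B (t : Set M)) :=
    Module.Finite.trans B _
  exact Module.Finite.of_injective ((Submodule.inclusion hsp).restrictScalars k)
    (Submodule.inclusion_injective hsp)
end spanfd

section mod
variable {k : Type} [Field k] {H : Type} [Ring H] [HopfAlgebra k H]
  {Hb : Type} [Ring Hb] [HopfAlgebra k Hb] {π : H →ₗ[k] Hb}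

lemma pi_conv (hπ : IsPi π) (f g : Module.Dual k Hb) :
    conv k f g ∘ₗ π = conv k (f ∘ₗ π) (g ∘ₗ π) := by
  refine LinearMap.ext fun x => ?_
  simp only [conv, LinearMap.comp_apply, hπ.com, TensorProduct.map_comp]

def piB (hπ : IsPi π) : Bd k Hb →+* Bd k H where
  toFun β := toConv (β.ofConv ∘ₗ π)
  map_one' := by
    apply WithConv.ofConv_injective
    refine LinearMap.ext fun x => ?_
    rw [one_apply']
    exact (one_apply' _).trans (hπ.cou x)
  map_mul' f g := by
    apply WithConv.ofConv_injective
    change (f * g).ofConv ∘ₗ π = _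
    rw [ofConv_mul, pi_conv hπ, ofConv_mul]
  map_zero' := rfl
  map_add' _ _ := rfl

def RD (_ : IsPi π) : Type := Bd k H

instance (hπ : IsPi π) : AddCommGroup (RD hπ) := inferInstanceAs (AddCommGroup (Bd k H))
instance (hπ : IsPi π) : Module k (RD hπ) := inferInstanceAs (Module k (Bd k H))
instance (hπ : IsPi π) : Module (Bd k Hb) (RD hπ) := Module.compHom (Bd k H) (piB hπ)

lemma RD_smul (hπ : IsPi π) (β : Bd k Hb) (f : RD hπ) :
    β • f = (piB hπ β * (show Bd k H from f) : Bd k H) := rfl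

instance (hπ : IsPi π) : IsScalarTower k (Bd k Hb) (RD hπ) where
  smul_assoc c β f := by
    rw [RD_smul, RD_smul]
    have : piB hπ (c • β) = c • piB hπ β := rfl
    rw [this]
    exact smul_mul_assoc c (piB hπ β) (show Bd k H from f)

def RDmod (hπ : IsPi π) : HopfMod π (RD hπ) where
  act := (dact (k := k) (H := H)).flip
  act_one f := by
    apply WithConv.ofConv_injective
    refine LinearMap.ext fun x => ?_
    exact congrArg _ (one_mul x)
  act_mul h h' f := by
    apply WithConv.ofConv_injective
    refine LinearMap.ext fun x => ?_
    exact congrArg _ (mul_assoc h h' x)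
  compat h n a b hab β f := by
    have h1 := dact_mul (piB hπ β) (show Bd k H from f) h a b hab
    refine h1.trans (Finset.sum_congr rfl fun i _ => ?_)
    rw [RD_smul]
    congr 1
    apply WithConv.ofConv_injective
    refine LinearMap.ext fun x => ?_
    exact congrArg _ (hπ.mul (a i) x)

def RDfin (hπ : IsPi π) [FiniteDimensional k Hb] : Submodule (Bd k Hb) (RD hπ) where
  carrier := {f | WithConv.ofConv (show Bd k H from f) ∈ finDual k H}
  add_mem' hf hg := finDual_add hf hg
  zero_mem' := finDual_zero
  smul_mem' β f hf := by
    have : WithConv.ofConv (show Bd k H from β • f) = conv k (β.ofConv ∘ₗ π)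
      (WithConv.ofConv (show Bd k H from f)) := ofConv_mul _ _
    show WithConv.ofConv (show Bd k H from β • f) ∈ finDual k H
    rw [this]
    exact finDual_conv (finDual_pi π hπ.mul _) hf

lemma RDfin_act (hπ : IsPi π) [FiniteDimensional k Hb] (h : H) (f : RD hπ) (hf : f ∈ RDfin hπ) :
    (RDmod hπ).act h f ∈ RDfin hπ := by
  obtain ⟨I, hI, hIf, hfd⟩ := hf
  exact ⟨I, hI, fun x hx => hIf (hI h x hx).1, hfd⟩

lemma RDfin_free (hπ : IsPi π) [FiniteDimensional k Hb] :
    Module.Free (Bd k Hb) (RDfin hπ) := by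
  refine HopfMod.free hπ ((RDmod hπ).sub (RDfin hπ) (RDfin_act hπ)) ?_
  rintro ⟨f, I, hI, hIf, hfd⟩
  let W : Set (RDfin hπ) := {g | I ≤ LinearMap.ker (WithConv.ofConv (show Bd k H from g.1))}
  refine ⟨Submodule.span (Bd k Hb) W, Submodule.subset_span hIf, ?_, ?_⟩
  · let Φ : Module.Dual k (H ⧸ I) →ₗ[k] RDfin hπ :=
      { toFun := fun φ => ⟨(toConv (φ ∘ₗ I.mkQ) : Bd k H), I, hI, fun x hx => by
          have : I.mkQ x = 0 := by simpa using hx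
          show φ (I.mkQ x) = 0
          rw [this, map_zero], hfd⟩
        map_add' := fun _ _ => rfl
        map_smul' := fun _ _ => rfl }
    have hW : W ⊆ LinearMap.range Φ := by
      intro g hg
      refine ⟨I.liftQ _ hg, Subtype.ext ?_⟩
      apply WithConv.ofConv_injective
      exact I.liftQ_mkQ _ hg
    exact span_fd W (LinearMap.range Φ) hW
  · refine HopfMod.span_stable ((RDmod hπ).sub (RDfin hπ) (RDfin_act hπ)) W ?_
    intro h g hg
    apply Submodule.subset_span
    intro x hx
    exact hg (hI h x hx).1

theorem left_free (hπ : IsPi π) [FiniteDimensional k Hb] :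
    ∃ (I : Type) (e : I → Module.Dual k H), (∀ i : I, e i ∈ finDual k H) ∧
      Function.Injective (fun c : I →₀ Module.Dual k Hb =>
        c.sum fun i β => conv k (piDual k H Hb π β) (e i)) ∧
      Set.range (fun c : I →₀ Module.Dual k Hb =>
        c.sum fun i β => conv k (piDual k H Hb π β) (e i)) = finDual k H := by
  have := RDfin_free hπ
  let b := Module.Free.chooseBasis (Bd k Hb) (RDfin hπ)
  let E : (Module.Free.ChooseBasisIndex (Bd k Hb) (RDfin hπ) →₀ Module.Dual k Hb) ≃+
      (Module.Free.ChooseBasisIndex (Bd k Hb) (RDfin hπ) →₀ Bd k Hb) :=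
    Finsupp.mapRange.addEquiv (WithConv.linearEquiv k (Hb →ₗ[k] k)).symm.toAddEquiv
  let T : RDfin hπ →+ Module.Dual k H :=
    { toFun := fun f => WithConv.ofConv (show Bd k H from f.1)
      map_zero' := rfl
      map_add' := fun _ _ => rfl }
  have hT : Function.Injective T := fun f g h => Subtype.ext (WithConv.ofConv_injective h)
  let e := fun i => T (b i)
  have key : (fun c : Module.Free.ChooseBasisIndex (Bd k Hb) (RDfin hπ) →₀ Module.Dual k Hb =>
        c.sum fun i β => conv k (piDual k H Hb π β) (e i)) = fun c => T (b.repr.symm (E c)) := by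
    funext c
    rw [Module.Basis.repr_symm_apply, Finsupp.linearCombination_apply]
    have h1 : (E c).sum (fun i a => a • b i) = c.sum fun i β => (toConv β : Bd k Hb) • b i := by
      refine Finsupp.sum_mapRange_index (hf := rfl) fun i => ?_
      exact zero_smul (Bd k Hb) (b i)
    rw [h1, Finsupp.sum, Finsupp.sum, map_sum]
    refine Finset.sum_congr rfl fun i _ => ?_
    exact (ofConv_mul _ _).symm
  refine ⟨_, e, fun i => (b i).2, ?_, ?_⟩
  · rw [key]
    exact hT.comp (b.repr.symm.injective.comp E.injective)
  · rw [key]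
    apply Set.eq_of_subset_of_subset
    · rintro _ ⟨c, rfl⟩
      exact (b.repr.symm (E c)).2
    · intro f hf
      refine ⟨E.symm (b.repr ⟨(toConv f : Bd k H), hf⟩), ?_⟩
      simp only [AddEquiv.apply_symm_apply, LinearEquiv.symm_apply_apply]
      rfl

end mod
end
end NZ

namespace NZ
noncomputable section
set_option linter.unusedSectionVars false

open WithConv Paper

section oc

def OC (H : Type) : Type := H

instance ocACG (H : Type) [Ring H] : AddCommGroup (OC H) := inferInstanceAs (AddCommGroup H)

instance (H : Type) [Ring H] : Ring (OC H) where
  __ := ocACG H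
  mul := fun a b => ((show H from b) * (show H from a) : H)
  one := (1 : H)
  mul_assoc := fun a b c => (mul_assoc (show H from c) (show H from b) (show H from a)).symm
  one_mul := fun a => mul_one (show H from a)
  mul_one := fun a => one_mul (show H from a)
  zero_mul := fun a => mul_zero (show H from a)
  mul_zero := fun a => zero_mul (show H from a)
  left_distrib := fun a b c => add_mul (show H from b) (show H from c) (show H from a)
  right_distrib := fun a b c => mul_add (show H from c) (show H from a) (show H from b)

variable {k : Type} [Field k] {H : Type} [Ring H] [HopfAlgebra k H]

instance : Module k (OC H) := inferInstanceAs (Module k H)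

instance : Algebra k (OC H) := Algebra.ofModule
  (fun r x y => mul_smul_comm r (show H from y) (show H from x))
  (fun r x y => smul_mul_assoc r (show H from y) (show H from x))

variable (k H) in
def toOC : H ≃ₗ[k] OC H := LinearEquiv.refl k H

lemma toOC_mul (x y : H) : toOC k H (x * y) = toOC k H y * toOC k H x := rfl
lemma toOC_one : toOC k H 1 = 1 := rfl

variable (k H) in
def tw : H ⊗[k] H ≃ₗ[k] OC H ⊗[k] OC H :=
  (TensorProduct.comm k H H).trans (TensorProduct.congr (toOC k H) (toOC k H))

lemma tw_tmul (x y : H) : tw k H (x ⊗ₜ y) = toOC k H y ⊗ₜ toOC k H x := rfl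

instance : CoalgebraStruct k (OC H) where
  comul := (tw k H).toLinearMap ∘ₗ comul ∘ₗ (toOC k H).symm.toLinearMap
  counit := counit ∘ₗ (toOC k H).symm.toLinearMap

lemma comul_toOC (x : H) : comul (R := k) (toOC k H x) = tw k H (comul x) := rfl
lemma counit_toOC (x : H) : counit (R := k) (toOC k H x) = counit (R := k) x := rfl

instance : Coalgebra k (OC H) where
  coassoc := by
    refine LinearMap.ext fun y => ?_
    obtain ⟨x, rfl⟩ := (toOC k H).surjective y
    simp only [LinearMap.comp_apply, LinearEquiv.coe_coe, comul_toOC]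
    have h1 : ∀ t : H ⊗[k] H, (comul (R := k) (A := OC H)).rTensor (OC H) (tw k H t) =
        TensorProduct.map (tw k H).toLinearMap (toOC k H).toLinearMap
          (TensorProduct.comm k H (H ⊗[k] H) ((comul (R := k) (A := H)).lTensor H t)) := by
      intro t
      induction t with
      | zero => simp
      | add x y hx hy => simp only [map_add, hx, hy]
      | tmul a b => simp [tw_tmul, comul_toOC]
    have h2 : ∀ t : H ⊗[k] H, (comul (R := k) (A := OC H)).lTensor (OC H) (tw k H t) =
        TensorProduct.map (toOC k H).toLinearMap (tw k H).toLinearMap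
          (TensorProduct.comm k (H ⊗[k] H) H ((comul (R := k) (A := H)).rTensor H t)) := by
      intro t
      induction t with
      | zero => simp
      | add x y hx hy => simp only [map_add, hx, hy]
      | tmul a b => simp [tw_tmul, comul_toOC]
    rw [h1, h2, ← Coalgebra.coassoc_apply]
    generalize (comul (R := k) (A := H)).rTensor H (comul x) = u
    induction u with
    | zero => simp
    | add x y hx hy => simp only [map_add, hx, hy]
    | tmul a b =>
      induction a with
      | zero => simp
      | add x y hx hy => simp only [TensorProduct.add_tmul, map_add, hx, hy]
      | tmul a c => simp [tw_tmul]
  rTensor_counit_comp_comul := by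
    refine LinearMap.ext fun y => ?_
    obtain ⟨x, rfl⟩ := (toOC k H).surjective y
    simp only [LinearMap.comp_apply, comul_toOC]
    have h1 : ∀ t : H ⊗[k] H, (counit (R := k) (A := OC H)).rTensor (OC H) (tw k H t) =
        TensorProduct.map LinearMap.id (toOC k H).toLinearMap
          (TensorProduct.comm k H k ((counit (R := k) (A := H)).lTensor H t)) := by
      intro t
      induction t with
      | zero => simp
      | add x y hx hy => simp only [map_add, hx, hy]
      | tmul a b => simp [tw_tmul, counit_toOC]
    rw [h1, Coalgebra.lTensor_counit_comul]
    simp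
  lTensor_counit_comp_comul := by
    refine LinearMap.ext fun y => ?_
    obtain ⟨x, rfl⟩ := (toOC k H).surjective y
    simp only [LinearMap.comp_apply, comul_toOC]
    have h1 : ∀ t : H ⊗[k] H, (counit (R := k) (A := OC H)).lTensor (OC H) (tw k H t) =
        TensorProduct.map (toOC k H).toLinearMap LinearMap.id
          (TensorProduct.comm k k H ((counit (R := k) (A := H)).rTensor H t)) := by
      intro t
      induction t with
      | zero => simp
      | add x y hx hy => simp only [map_add, hx, hy]
      | tmul a b => simp [tw_tmul, counit_toOC]
    rw [h1, Coalgebra.rTensor_counit_comul]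
    simp

lemma tw_mul (s t : H ⊗[k] H) : tw k H (s * t) = tw k H t * tw k H s := by
  induction s with
  | zero => simp
  | add x y hx hy => simp only [add_mul, mul_add, map_add, hx, hy]
  | tmul a b =>
    induction t with
    | zero => simp
    | add x y hx hy => simp only [add_mul, mul_add, map_add, hx, hy]
    | tmul c d =>
      rw [Algebra.TensorProduct.tmul_mul_tmul, tw_tmul, tw_tmul, tw_tmul,
        Algebra.TensorProduct.tmul_mul_tmul, toOC_mul, toOC_mul]

instance : Bialgebra k (OC H) := Bialgebra.mk' k (OC H)
  (Bialgebra.counit_one (R := k) (A := H))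
  (fun {a b} => (Bialgebra.counit_mul (R := k) (A := H) b a).trans (mul_comm _ _))
  (by
    rw [← toOC_one (k := k), comul_toOC, Bialgebra.comul_one, Algebra.TensorProduct.one_def, tw_tmul]
    rfl)
  (fun {a b} => by
    obtain ⟨x, rfl⟩ := (toOC k H).surjective a
    obtain ⟨y, rfl⟩ := (toOC k H).surjective b
    rw [← toOC_mul, comul_toOC, comul_toOC, comul_toOC, Bialgebra.comul_mul, tw_mul])

instance : HopfAlgebra k (OC H) where
  antipode := (toOC k H).toLinearMap ∘ₗ HopfAlgebra.antipode k ∘ₗ (toOC k H).symm.toLinearMap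
  mul_antipode_rTensor_comul := by
    refine LinearMap.ext fun y => ?_
    obtain ⟨x, rfl⟩ := (toOC k H).surjective y
    have h1 : ∀ t : H ⊗[k] H, LinearMap.mul' k (OC H) (((toOC k H).toLinearMap ∘ₗ
        HopfAlgebra.antipode k ∘ₗ (toOC k H).symm.toLinearMap).rTensor (OC H) (tw k H t)) =
        toOC k H (LinearMap.mul' k H ((HopfAlgebra.antipode k).lTensor H t)) := by
      intro t
      induction t with
      | zero => simp
      | add x y hx hy => simp only [map_add, hx, hy]
      | tmul a b => simp [tw_tmul, toOC_mul]
    have h2 := HopfAlgebra.mul_antipode_lTensor_comul_apply (R := k) x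
    simp only [LinearMap.comp_apply, comul_toOC]
    refine (h1 _).trans ?_
    rw [h2, Algebra.linearMap_apply, Algebra.algebraMap_eq_smul_one, Algebra.algebraMap_eq_smul_one,
      map_smul, counit_toOC, toOC_one]
  mul_antipode_lTensor_comul := by
    refine LinearMap.ext fun y => ?_
    obtain ⟨x, rfl⟩ := (toOC k H).surjective y
    have h1 : ∀ t : H ⊗[k] H, LinearMap.mul' k (OC H) (((toOC k H).toLinearMap ∘ₗ
        HopfAlgebra.antipode k ∘ₗ (toOC k H).symm.toLinearMap).lTensor (OC H) (tw k H t)) =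
        toOC k H (LinearMap.mul' k H ((HopfAlgebra.antipode k).rTensor H t)) := by
      intro t
      induction t with
      | zero => simp
      | add x y hx hy => simp only [map_add, hx, hy]
      | tmul a b => simp [tw_tmul, toOC_mul]
    have h2 := HopfAlgebra.mul_antipode_rTensor_comul_apply (R := k) x
    simp only [LinearMap.comp_apply, comul_toOC]
    refine (h1 _).trans ?_
    rw [h2, Algebra.linearMap_apply, Algebra.algebraMap_eq_smul_one, Algebra.algebraMap_eq_smul_one,
      map_smul, counit_toOC, toOC_one]

lemma conv_OC (f g : Module.Dual k (OC H)) :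
    conv k f g ∘ₗ (toOC k H).toLinearMap =
      conv k (g ∘ₗ (toOC k H).toLinearMap) (f ∘ₗ (toOC k H).toLinearMap) := by
  refine LinearMap.ext fun x => ?_
  simp only [conv, LinearMap.comp_apply, LinearEquiv.coe_coe, comul_toOC]
  generalize comul (R := k) x = t
  induction t with
  | zero => simp
  | add x y hx hy => simp only [map_add, hx, hy]
  | tmul a b => simp [tw_tmul, mul_comm]

variable {Hb : Type} [Ring Hb] [HopfAlgebra k Hb] {π : H →ₗ[k] Hb}

def piOC (π : H →ₗ[k] Hb) : OC H →ₗ[k] OC Hb :=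
  (toOC k Hb).toLinearMap ∘ₗ π ∘ₗ (toOC k H).symm.toLinearMap

lemma piOC_isPi (hπ : IsPi π) : IsPi (piOC π) where
  surj := hπ.surj
  one := hπ.one
  mul x y := hπ.mul y x
  com y := by
    obtain ⟨x, rfl⟩ := (toOC k H).surjective y
    have : piOC π (toOC k H x) = toOC k Hb (π x) := rfl
    rw [this, comul_toOC, comul_toOC, hπ.com]
    generalize comul (R := k) x = t
    induction t with
    | zero => simp
    | add x y hx hy => simp only [map_add, hx, hy]
    | tmul a b => rfl
  cou := hπ.cou

lemma finDual_OC : finDual k (OC H) = finDual k H := by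
  apply Set.eq_of_subset_of_subset
  · rintro f ⟨I, hI, hf, hfd⟩
    exact ⟨I, fun h x hx => (hI h x hx).symm, hf, hfd⟩
  · rintro f ⟨I, hI, hf, hfd⟩
    exact ⟨I, fun h x hx => (hI h x hx).symm, hf, hfd⟩

theorem right_free (hπ : IsPi π) [hfd : FiniteDimensional k Hb] :
    ∃ (I : Type) (e : I → Module.Dual k H), (∀ i : I, e i ∈ finDual k H) ∧
      Function.Injective (fun c : I →₀ Module.Dual k Hb =>
        c.sum fun i β => conv k (e i) (piDual k H Hb π β)) ∧
      Set.range (fun c : I →₀ Module.Dual k Hb =>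
        c.sum fun i β => conv k (e i) (piDual k H Hb π β)) = finDual k H := by
  have : FiniteDimensional k (OC Hb) := hfd
  obtain ⟨I, e, he, hinj, hran⟩ := left_free (piOC_isPi hπ)
  have key : ∀ c : I →₀ Module.Dual k Hb,
      (c.sum fun i β => conv k (show Module.Dual k H from e i) (piDual k H Hb π β)) =
      (show I →₀ Module.Dual k (OC Hb) from c).sum
        fun i β => conv k (piDual k (OC H) (OC Hb) (piOC π) β) (e i) := by
    intro c
    refine Finset.sum_congr rfl fun i _ => ?_
    exact (conv_OC (piDual k (OC H) (OC Hb) (piOC π) (c i)) (e i)).symm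
  have key' := funext key
  refine ⟨I, e, fun i => ?_, ?_, ?_⟩
  · rw [← finDual_OC]; exact he i
  · rw [key']; exact hinj
  · rw [key', ← finDual_OC]; exact hran
end oc
end
end NZ

open Paper in
/-- For an affine commutative-by-finite Hopf algebra `A ⊆ H`
(with `A` semiprime or central, or `H` pointed), the finite dual `H°` is a free
left and right module over the finite-dimensional normal Hopf subalgebra
`H̄* = {f ∈ H° : f(A⁺H) = 0}` (identified with the image of `π°`, the module
actions being given by convolution). Freeness is expressed by the existence of
a basis `e` such that `(βᵢ) ↦ Σ π°(βᵢ) * e i` is a bijection onto `H°`. -/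
theorem statement_1
    (k : Type) [Field k] [IsAlgClosed k]
    (A : Type) [CommRing A] [HopfAlgebra k A]
    (H : Type) [Ring H] [HopfAlgebra k H]
    (Hb : Type) [Ring Hb] [HopfAlgebra k Hb]
    (ι : A →ₗ[k] H) (π : H →ₗ[k] Hb)
    (hCbF : CommByFinite k A H ι)
    (hQ : IsHbarQuotient k A H Hb ι π)
    (hyp : StandingHyp k A H ι) :
    -- `H°` is a free left `H̄*`-module
    (∃ (I : Type) (e : I → Module.Dual k H), (∀ i : I, e i ∈ finDual k H) ∧
      Function.Injective (fun c : I →₀ Module.Dual k Hb =>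
        c.sum fun i β => conv k (piDual k H Hb π β) (e i)) ∧
      Set.range (fun c : I →₀ Module.Dual k Hb =>
        c.sum fun i β => conv k (piDual k H Hb π β) (e i)) = finDual k H) ∧
    -- `H°` is a free right `H̄*`-module
    (∃ (I : Type) (e : I → Module.Dual k H), (∀ i : I, e i ∈ finDual k H) ∧
      Function.Injective (fun c : I →₀ Module.Dual k Hb =>
        c.sum fun i β => conv k (e i) (piDual k H Hb π β)) ∧
      Set.range (fun c : I →₀ Module.Dual k Hb =>
        c.sum fun i β => conv k (e i) (piDual k H Hb π β)) = finDual k H) := by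
  have hπ : NZ.IsPi π := ⟨hQ.π_surj, hQ.π_one, hQ.π_mul, hQ.π_comul, hQ.π_counit⟩
  have := hQ.findim
  exact ⟨NZ.left_free hπ, NZ.right_free hπ⟩
end

section
/- Let A ⊆ H be an affine commutative-by-finite Hopf algebra with A semiprime or central in H, or H pointed, and let Π : H → A be the projection along a right A-module complement X of A in H. Then (H̄*)⁺H° is a Hopf ideal of H° contained in ker ι°, and H° decomposes as a vector space as H° = ker ι° ⊕ Π°(A°); consequently (H̄*)⁺H° ⊕ Π°(A°) ⊆ ker ι° ⊕ Π°(A°) = H°. -/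
open TensorProduct LinearMap Coalgebra

namespace Paper

open WithConv HopfAlgebra

section helpers

variable {k : Type} [Field k]

lemma conv_repr {C : Type} [AddCommMonoid C] [Module k C] [Coalgebra k C]
    {κ : Type} {x : C} (R : Coalgebra.Repr k x κ) (f g : Module.Dual k C) :
    conv k f g x = ∑ i ∈ R.index, f (R.left i) * g (R.right i) := by
  simp [conv, ← R.eq]

lemma conv_eq {C : Type} [AddCommMonoid C] [Module k C] [Coalgebra k C]
    (f g : Module.Dual k C) :
    conv k f g = (toConv f * toConv g : WithConv (C →ₗ[k] k)).ofConv := by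
  ext x
  rw [conv_repr (ℛ k x)]
  exact ((ℛ k x).convMul_apply (toConv f) (toConv g)).symm

lemma conv_assoc' {C : Type} [AddCommMonoid C] [Module k C] [Coalgebra k C]
    (f g h : Module.Dual k C) : conv k (conv k f g) h = conv k f (conv k g h) := by
  simp only [conv_eq, toConv_ofConv, mul_assoc]

lemma conv_add_left {C : Type} [AddCommMonoid C] [Module k C] [Coalgebra k C]
    (f g h : Module.Dual k C) : conv k (f + g) h = conv k f h + conv k g h := by
  simp [conv_eq, add_mul]

lemma conv_add_right {C : Type} [AddCommMonoid C] [Module k C] [Coalgebra k C]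
    (f g h : Module.Dual k C) : conv k f (g + h) = conv k f g + conv k f h := by
  simp [conv_eq, mul_add]

lemma conv_smul_left {C : Type} [AddCommMonoid C] [Module k C] [Coalgebra k C]
    (c : k) (f h : Module.Dual k C) : conv k (c • f) h = c • conv k f h := by
  ext x
  simp [conv_repr (ℛ k x), Finset.mul_sum, mul_assoc, mul_left_comm]

lemma conv_smul_right {C : Type} [AddCommMonoid C] [Module k C] [Coalgebra k C]
    (c : k) (f h : Module.Dual k C) : conv k f (c • h) = c • conv k f h := by
  ext x
  simp [conv_repr (ℛ k x), Finset.mul_sum, mul_assoc, mul_left_comm]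

/-- product representation -/
def reprMul {H : Type} [Ring H] [HopfAlgebra k H] {κ μ : Type} {x y : H}
    (R : Coalgebra.Repr k x κ) (R' : Coalgebra.Repr k y μ) :
    Coalgebra.Repr k (x * y) (κ × μ) where
  index := R.index ×ˢ R'.index
  left i := R.left i.1 * R'.left i.2
  right i := R.right i.1 * R'.right i.2
  eq := by
    rw [Bialgebra.comul_mul, ← R.eq, ← R'.eq, Finset.sum_mul_sum, Finset.sum_product]
    simp

section FD
variable {H : Type} [Ring H] [Algebra k H]

lemma finDual_of_left (f : Module.Dual k H) (L : Submodule H H)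
    (hL : ∀ x ∈ L, f x = 0) (hfin : Module.Finite k (H ⧸ L)) : f ∈ finDual k H := by
  let φ : H →ₐ[k] Module.End k (H ⧸ L) := Algebra.lsmul k k (H ⧸ L)
  refine ⟨LinearMap.ker φ.toLinearMap, ?_, ?_, ?_⟩
  · intro h x hx
    have hx' : φ x = 0 := hx
    constructor
    · change φ (h * x) = 0
      rw [map_mul, hx', mul_zero]
    · change φ (x * h) = 0
      rw [map_mul, hx', zero_mul]
  · intro x hx
    have hx' : φ x = 0 := hx
    have := LinearMap.congr_fun hx' (Submodule.Quotient.mk (1 : H))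
    have h2 : (Submodule.Quotient.mk (x * 1) : H ⧸ L) = 0 := this
    rw [Submodule.Quotient.mk_eq_zero, mul_one] at h2
    exact hL x h2
  · exact Module.Finite.equiv (LinearMap.quotKerEquivRange φ.toLinearMap).symm

lemma finDual_of_sum {κ : Type} [Fintype κ] (f : Module.Dual k H)
    (s t : κ → Module.Dual k H) (h : ∀ x y, f (x * y) = ∑ i, s i x * t i y) :
    f ∈ finDual k H := by
  let L : Submodule H H :=
    { carrier := {y | ∀ x, f (x * y) = 0}
      zero_mem' := by intro x; simp
      add_mem' := by
        intro a b ha hb x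
        rw [mul_add, map_add, ha x, hb x, add_zero]
      smul_mem' := by
        intro c a ha x
        rw [smul_eq_mul, ← mul_assoc]; exact ha _ }
  refine finDual_of_left f L (fun x hx => by simpa using hx 1) ?_
  let P : H →ₗ[k] (κ → k) := LinearMap.pi t
  have hle : LinearMap.ker P ≤ L.restrictScalars k := by
    intro y hy x
    have : ∀ i, t i y = 0 := fun i => congrFun (show P y = 0 from hy) i
    rw [h]; simp [this]
  have : Module.Finite k (H ⧸ LinearMap.ker P) :=
    Module.Finite.equiv (LinearMap.quotKerEquivRange P).symm
  have : Module.Finite k (H ⧸ L.restrictScalars k) :=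
    Module.Finite.of_surjective (Submodule.factor hle) (Submodule.factor_surjective hle)
  exact Module.Finite.equiv (Submodule.Quotient.restrictScalarsEquiv k L)

lemma finDual_transl (f : Module.Dual k H) (hf : f ∈ finDual k H) (y : H) :
    f ∘ₗ LinearMap.mulRight k y ∈ finDual k H := by
  obtain ⟨I, hI, hle, hfin⟩ := hf
  exact ⟨I, hI, fun x hx => hle (hI y x hx).2, hfin⟩

lemma finDual_split (f : Module.Dual k H) (hf : f ∈ finDual k H) :
    ∃ (n : ℕ) (y : Fin n → H) (v : Fin n → Module.Dual k H), (∀ i, v i ∈ finDual k H) ∧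
      ∀ x z, f (x * z) = ∑ i, f (x * y i) * v i z := by
  obtain ⟨I, hI, hle, hfin⟩ := hf
  let b := Module.finBasis k (H ⧸ I)
  choose y hy using fun i => Submodule.Quotient.mk_surjective I (b i)
  refine ⟨_, y, fun i => b.coord i ∘ₗ I.mkQ, fun i => ⟨I, hI, ?_, hfin⟩, ?_⟩
  · intro x hx
    simp [(Submodule.Quotient.mk_eq_zero I).2 hx]
  · intro x z
    have h1 : z - ∑ i, b.coord i (I.mkQ z) • y i ∈ I := by
      rw [← Submodule.Quotient.mk_eq_zero, ← Submodule.mkQ_apply, map_sub, map_sum]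
      simp only [map_smul, Submodule.mkQ_apply, hy]
      rw [sub_eq_zero]
      exact (b.sum_repr _).symm
    have h2 : f (x * (z - ∑ i, b.coord i (I.mkQ z) • y i)) = 0 := hle (hI x _ h1).1
    rw [mul_sub, map_sub, sub_eq_zero] at h2
    rw [h2, Finset.mul_sum, map_sum]
    refine Finset.sum_congr rfl fun i _ => ?_
    rw [mul_smul_comm, map_smul, smul_eq_mul, mul_comm]
    rfl

lemma finDual_split' (f : Module.Dual k H) (hf : f ∈ finDual k H) :
    ∃ (n : ℕ) (u v : Fin n → Module.Dual k H), (∀ i, u i ∈ finDual k H) ∧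
      (∀ i, v i ∈ finDual k H) ∧ ∀ x z, f (x * z) = ∑ i, u i x * v i z := by
  obtain ⟨n, y, v, hv, h⟩ := finDual_split f hf
  exact ⟨n, fun i => f ∘ₗ LinearMap.mulRight k (y i), v, fun i => finDual_transl f hf _, hv,
    fun x z => h x z⟩

lemma finDual_add {f g : Module.Dual k H} (hf : f ∈ finDual k H) (hg : g ∈ finDual k H) :
    f + g ∈ finDual k H := by
  obtain ⟨n, u, v, -, -, h⟩ := finDual_split' f hf
  obtain ⟨m, u', v', -, -, h'⟩ := finDual_split' g hg
  refine finDual_of_sum (κ := Fin n ⊕ Fin m) _ (Sum.elim u u') (Sum.elim v v') fun x y => ?_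
  simp [h, h']

lemma finDual_smul {f : Module.Dual k H} (hf : f ∈ finDual k H) (c : k) :
    c • f ∈ finDual k H := by
  obtain ⟨I, hI, hle, hfin⟩ := hf
  exact ⟨I, hI, fun x hx => by simp [show f x = 0 from hle hx], hfin⟩

lemma finDual_zero : (0 : Module.Dual k H) ∈ finDual k H :=
  finDual_of_sum (κ := Fin 0) _ (fun _ => 0) (fun _ => 0) (by simp)

variable (k H) in
/-- finite dual as a submodule -/
def FD : Submodule k (Module.Dual k H) where
  carrier := finDual k H
  zero_mem' := finDual_zero
  add_mem' := finDual_add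
  smul_mem' c _ hf := finDual_smul hf c

end FD

variable {H : Type} [Ring H] [HopfAlgebra k H]

lemma conv_mul_apply {κ μ : Type} [Fintype κ] [Fintype μ] (f g : Module.Dual k H)
    (s t : κ → Module.Dual k H) (s' t' : μ → Module.Dual k H)
    (h : ∀ x y, f (x * y) = ∑ i, s i x * t i y)
    (h' : ∀ x y, g (x * y) = ∑ i, s' i x * t' i y) (x y : H) :
    conv k f g (x * y) =
      ∑ p : κ × μ, conv k (s p.1) (s' p.2) x * conv k (t p.1) (t' p.2) y := by
  rw [conv_repr (reprMul (ℛ k x) (ℛ k y))]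
  simp only [conv_repr (ℛ k x), conv_repr (ℛ k y), reprMul, h, h', Finset.sum_mul_sum]
  simp only [← Finset.univ_product_univ, Finset.sum_product]
  have : ∀ (F : κ → μ → H × H → H × H → k),
    ∑ a ∈ (ℛ k x).index, ∑ b ∈ (ℛ k y).index, ∑ i, ∑ j, F i j a b =
    ∑ i, ∑ j, ∑ a ∈ (ℛ k x).index, ∑ b ∈ (ℛ k y).index, F i j a b := by
    intro F
    calc _ = ∑ a ∈ (ℛ k x).index, ∑ i, ∑ b ∈ (ℛ k y).index, ∑ j, F i j a b :=
          Finset.sum_congr rfl fun a _ => Finset.sum_comm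
      _ = ∑ i, ∑ a ∈ (ℛ k x).index, ∑ b ∈ (ℛ k y).index, ∑ j, F i j a b := Finset.sum_comm
      _ = ∑ i, ∑ a ∈ (ℛ k x).index, ∑ j, ∑ b ∈ (ℛ k y).index, F i j a b :=
          Finset.sum_congr rfl fun i _ => Finset.sum_congr rfl fun a _ => Finset.sum_comm
      _ = _ := Finset.sum_congr rfl fun i _ => Finset.sum_comm
  rw [← this]
  refine Finset.sum_congr rfl fun a _ => Finset.sum_congr rfl fun b _ =>
    Finset.sum_congr rfl fun i _ => Finset.sum_congr rfl fun j _ => by ring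

lemma finDual_conv {f g : Module.Dual k H} (hf : f ∈ finDual k H) (hg : g ∈ finDual k H) :
    conv k f g ∈ finDual k H := by
  obtain ⟨n, u, v, -, -, h⟩ := finDual_split' f hf
  obtain ⟨m, u', v', -, -, h'⟩ := finDual_split' g hg
  exact finDual_of_sum _ _ _ (conv_mul_apply f g u v u' v' h h')

lemma finDual_antipode {f : Module.Dual k H} (hf : f ∈ finDual k H) :
    f ∘ₗ antipode k ∈ finDual k H := by
  obtain ⟨n, u, v, -, -, h⟩ := finDual_split' f hf
  refine finDual_of_sum _ (fun i => v i ∘ₗ antipode k) (fun i => u i ∘ₗ antipode k) fun x y => ?_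
  simp only [LinearMap.comp_apply, antipode_mul_antidistrib, h]
  exact Finset.sum_congr rfl fun i _ => mul_comm _ _

lemma finDual_counit : (Coalgebra.counit : Module.Dual k H) ∈ finDual k H :=
  finDual_of_sum (κ := Fin 1) _ (fun _ => Coalgebra.counit) (fun _ => Coalgebra.counit)
    (by simp)

/-- anti-comultiplicativity of the antipode -/
lemma comul_antipode (h : H) :
    Coalgebra.comul (R := k) (antipode k h) =
      TensorProduct.map (antipode k) (antipode k)
        (TensorProduct.comm k H H (Coalgebra.comul h)) := by
  let i1 : H →ₐ[k] H ⊗[k] H := Algebra.TensorProduct.includeLeft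
  let i2 : H →ₐ[k] H ⊗[k] H := Algebra.TensorProduct.includeRight
  let D : H →ₐ[k] H ⊗[k] H := Bialgebra.comulAlgHom k H
  have key : ∀ j : H →ₐ[k] H ⊗[k] H,
      toConv (j.toLinearMap ∘ₗ antipode k) * toConv j.toLinearMap = 1 ∧
      toConv j.toLinearMap * toConv (j.toLinearMap ∘ₗ antipode k) = 1 := by
    intro j
    have h1 := algHom_comp_convMul_distrib j (toConv (antipode k (A := H))) (toConv .id)
    have h2 := algHom_comp_convMul_distrib j (toConv .id) (toConv (antipode k (A := H)))
    rw [antipode_mul_id] at h1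
    rw [id_mul_antipode] at h2
    constructor
    · apply WithConv.ext
      refine h1.symm.trans ?_
      ext x
      simp [LinearMap.convOne_def]
    · apply WithConv.ext
      refine h2.symm.trans ?_
      ext x
      simp [LinearMap.convOne_def]
  have hD : toConv D.toLinearMap = toConv i1.toLinearMap * toConv i2.toLinearMap := by
    ext x
    rw [(ℛ k x).convMul_apply]
    simp [D, i1, i2, (ℛ k x).eq]
  have hG : toConv (TensorProduct.map (antipode k) (antipode k) ∘ₗ
        (TensorProduct.comm k H H).toLinearMap ∘ₗ Coalgebra.comul) =
      toConv (i2.toLinearMap ∘ₗ antipode k) * toConv (i1.toLinearMap ∘ₗ antipode k) := by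
    ext x
    rw [(ℛ k x).convMul_apply]
    simp [i1, i2, ← (ℛ k x).eq]
  have e : toConv (D.toLinearMap ∘ₗ antipode k) =
      toConv (i2.toLinearMap ∘ₗ antipode k) * toConv (i1.toLinearMap ∘ₗ antipode k) := by
    refine left_inv_eq_right_inv (key D).1 ?_
    rw [hD, mul_assoc, ← mul_assoc (toConv i2.toLinearMap), (key i2).2, one_mul, (key i1).2]
  rw [← hG] at e
  exact LinearMap.congr_fun (congrArg WithConv.ofConv e) h

lemma conv_antipode (f g : Module.Dual k H) :
    conv k f g ∘ₗ antipode k = conv k (g ∘ₗ antipode k) (f ∘ₗ antipode k) := by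
  ext h
  rw [conv_repr (ℛ k h)]
  simp [conv, comul_antipode, ← (ℛ k h).eq, mul_comm]

/-- `T(h) = t(h) 1` -/
def TT (t : Module.Dual k H) : H →ₗ[k] H := Algebra.linearMap k H ∘ₗ t

/-- `Ψ(h) = Σ t(h₁) S(h₂)` -/
noncomputable def PsiC (t : Module.Dual k H) : WithConv (H →ₗ[k] H) := toConv (TT t) * toConv (antipode k)

/-- `Φ(h) = Σ h₁ t(h₂) S(h₃)` -/
noncomputable def PhiC (t : Module.Dual k H) : WithConv (H →ₗ[k] H) := toConv (LinearMap.id : H →ₗ[k] H) * PsiC t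

lemma PhiC_mul_id (t : Module.Dual k H) :
    PhiC t * toConv (LinearMap.id : H →ₗ[k] H) = toConv (LinearMap.id : H →ₗ[k] H) * toConv (TT t) := by
  rw [PhiC, PsiC, mul_assoc, mul_assoc, antipode_mul_id, mul_one]

lemma PsiC_repr {κ : Type} (t : Module.Dual k H) {h : H} (R : Coalgebra.Repr k h κ) :
    (PsiC t).ofConv h = ∑ i ∈ R.index, t (R.left i) • antipode k (R.right i) := by
  refine (R.convMul_apply _ _).trans ?_
  simp [TT, Algebra.smul_def]

lemma PhiC_repr {κ : Type} (t : Module.Dual k H) {h : H} (R : Coalgebra.Repr k h κ) :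
    (PhiC t).ofConv h = ∑ i ∈ R.index, R.left i * (PsiC t).ofConv (R.right i) := by
  exact (R.convMul_apply _ _).trans rfl

/-- `g * t = Σ (u_i ∘ Φ_t) * v_i`. -/
lemma conv_swap {κ : Type} [Fintype κ] (g t : Module.Dual k H) (u v : κ → Module.Dual k H)
    (h : ∀ x y, g (x * y) = ∑ i, u i x * v i y) :
    conv k g t = ∑ i, conv k (u i ∘ₗ (PhiC t).ofConv) (v i) := by
  ext x
  have e := congrArg g (LinearMap.congr_fun (congrArg WithConv.ofConv (PhiC_mul_id t)) x)
  have e1 : (PhiC t * toConv (LinearMap.id : H →ₗ[k] H)).ofConv x = _ := (ℛ k x).convMul_apply _ _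
  have e2 : (toConv (LinearMap.id : H →ₗ[k] H) * toConv (TT t)).ofConv x = _ := (ℛ k x).convMul_apply _ _
  rw [e1, e2, map_sum, map_sum] at e
  rw [conv_repr (ℛ k x), LinearMap.sum_apply]
  simp only [conv_repr (ℛ k x)]
  rw [Finset.sum_comm]
  trans
  · exact (Finset.sum_congr rfl fun i _ => by
      change _ = g ((ℛ k x).left i * algebraMap k H (t ((ℛ k x).right i)))
      rw [← Algebra.commutes, ← Algebra.smul_def, map_smul, smul_eq_mul, mul_comm]
      ) |>.trans e.symm
  · exact Finset.sum_congr rfl fun i _ => by rw [h]; rfl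

lemma finDual_Phi {u t : Module.Dual k H} (hu : u ∈ finDual k H) (ht : t ∈ finDual k H) :
    u ∘ₗ (PhiC t).ofConv ∈ finDual k H := by
  obtain ⟨n, a, b, ha, hb, h⟩ := finDual_split' u hu
  have : u ∘ₗ (PhiC t).ofConv = ∑ i, conv k (a i) (conv k t (b i ∘ₗ antipode k)) := by
    ext x
    rw [LinearMap.comp_apply, PhiC_repr t (ℛ k x), map_sum, LinearMap.sum_apply]
    simp only [conv_repr (ℛ k x), h]
    rw [Finset.sum_comm]
    refine Finset.sum_congr rfl fun i _ => Finset.sum_congr rfl fun j _ => ?_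
    congr 1
    rw [PsiC_repr t (ℛ k _), conv_repr (ℛ k _), map_sum]
    simp
  rw [this]
  exact (FD k H).sum_mem fun i _ => finDual_conv (ha i) (finDual_conv ht (finDual_antipode (hb i)))

section Ext

variable {A : Type} [CommRing A] [HopfAlgebra k A] {ι : A →ₗ[k] H}

/-- image representation -/
def reprMap (hC : CommByFinite k A H ι) {κ : Type} {a : A} (R : Coalgebra.Repr k a κ) :
    Coalgebra.Repr k (ι a) κ where
  index := R.index
  left i := ι (R.left i)
  right i := ι (R.right i)
  eq := by rw [hC.ι_comul, ← R.eq]; simp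

lemma adl_repr {κ : Type} {h : H} (R : Coalgebra.Repr k h κ) (x : H) :
    adl k H h x = ∑ i ∈ R.index, R.left i * x * antipode k (R.right i) := by
  simp [adl, ← R.eq]

lemma adr_repr {κ : Type} {h : H} (R : Coalgebra.Repr k h κ) (x : H) :
    adr k H h x = ∑ i ∈ R.index, antipode k (R.left i) * x * R.right i := by
  simp [adr, ← R.eq]

lemma mul_eq_adl {κ : Type} {h : H} (R : Coalgebra.Repr k h κ) (x : H) :
    h * x = ∑ i ∈ R.index, adl k H (R.left i) x * R.right i := by
  have e : toConv (LinearMap.mulRight k x) * toConv (antipode k) * toConv (LinearMap.id : H →ₗ[k] H)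
      = toConv (LinearMap.mulRight k x) := by rw [mul_assoc, antipode_mul_id, mul_one]
  have e1 := LinearMap.congr_fun (congrArg WithConv.ofConv e) h
  refine e1.symm.trans ((R.convMul_apply _ _).trans (Finset.sum_congr rfl fun i _ => ?_))
  rw [adl_repr (ℛ k _)]
  refine congrArg (· * R.right i) ?_
  exact ((ℛ k (R.left i)).convMul_apply _ _).trans rfl

lemma mul_eq_adr {κ : Type} {h : H} (R : Coalgebra.Repr k h κ) (x : H) :
    x * h = ∑ i ∈ R.index, R.left i * adr k H (R.right i) x := by
  have e : toConv (LinearMap.id : H →ₗ[k] H) * (toConv (antipode k) * toConv (LinearMap.mulLeft k x))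
      = toConv (LinearMap.mulLeft k x) := by rw [← mul_assoc, id_mul_antipode, one_mul]
  have e1 := LinearMap.congr_fun (congrArg WithConv.ofConv e) h
  refine e1.symm.trans ((R.convMul_apply _ _).trans (Finset.sum_congr rfl fun i _ => ?_))
  rw [adr_repr (ℛ k _)]
  refine congrArg (R.left i * ·) ?_
  refine ((ℛ k (R.right i)).convMul_apply _ _).trans (Finset.sum_congr rfl fun j _ => ?_)
  simp [mul_assoc]

lemma counit_adl (h x : H) (hx : Coalgebra.counit (R := k) x = 0) :
    Coalgebra.counit (R := k) (adl k H h x) = 0 := by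
  rw [adl_repr (ℛ k h)]; simp [hx]

lemma counit_adr (h x : H) (hx : Coalgebra.counit (R := k) x = 0) :
    Coalgebra.counit (R := k) (adr k H h x) = 0 := by
  rw [adr_repr (ℛ k h)]; simp [hx]

/-- `HA⁺ ⊆ A⁺H`. -/
lemma mul_mem_aug (hC : CommByFinite k A H ι) (h : H) (a : A)
    (ha : Coalgebra.counit (R := k) a = 0) : h * ι a ∈ augHIdeal k A H ι := by
  rw [mul_eq_adl (ℛ k h)]
  refine Submodule.sum_mem _ fun i _ => ?_
  obtain ⟨b, hb⟩ := hC.normal_left ((ℛ k h).left i) a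
  refine Submodule.subset_span ⟨b, _, ?_, by rw [hb]⟩
  rw [← hC.ι_counit, hb]
  exact counit_adl _ _ (by rw [hC.ι_counit, ha])

lemma hbar_right (hC : CommByFinite k A H ι) {t : Module.Dual k H}
    (ht : t ∈ hbarStar k A H ι) (b : H) (a : A) :
    t (b * ι a) = Coalgebra.counit (R := k) a * t b := by
  have h1 := ht _ (mul_mem_aug hC b (a - algebraMap k A (Coalgebra.counit a)) (by simp))
  have h2 : ι (algebraMap k A (Coalgebra.counit (R := k) a)) =
      Coalgebra.counit (R := k) a • 1 := by
    rw [Algebra.algebraMap_eq_smul_one, map_smul, hC.ι_one]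
  rw [map_sub, mul_sub, map_sub, h2, sub_eq_zero] at h1
  rw [h1]; simp

lemma Psi_mul (hC : CommByFinite k A H ι) {t : Module.Dual k H}
    (ht : t ∈ hbarStar k A H ι) (b : H) (a : A) :
    (PsiC t).ofConv (b * ι a) = antipode k (ι a) * (PsiC t).ofConv b := by
  rw [PsiC_repr t (reprMul (ℛ k b) (reprMap hC (ℛ k a))), PsiC_repr t (ℛ k b)]
  simp only [reprMul, reprMap, Finset.sum_product, hbar_right hC ht, antipode_mul_antidistrib]
  rw [Finset.mul_sum]
  refine Finset.sum_congr rfl fun i _ => ?_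
  have : ι a = ∑ j ∈ (ℛ k a).index, Coalgebra.counit (R := k) ((ℛ k a).left j) •
      ι ((ℛ k a).right j) := by
    conv_lhs => rw [← Coalgebra.sum_counit_smul (ℛ k a)]
    simp
  rw [this, map_sum, Finset.sum_mul]
  refine Finset.sum_congr rfl fun j _ => ?_
  rw [map_smul, smul_mul_assoc, mul_smul_comm, smul_smul]

lemma Phi_mul (hC : CommByFinite k A H ι) {t : Module.Dual k H}
    (ht : t ∈ hbarStar k A H ι) (b : H) (a : A) :
    (PhiC t).ofConv (b * ι a) = Coalgebra.counit (R := k) a • (PhiC t).ofConv b := by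
  rw [PhiC_repr t (reprMul (ℛ k b) (reprMap hC (ℛ k a))), PhiC_repr t (ℛ k b)]
  simp only [reprMul, Finset.sum_product]
  rw [Finset.smul_sum]
  refine Finset.sum_congr rfl fun i _ => ?_
  have : ∑ j ∈ (reprMap hC (ℛ k a)).index, (reprMap hC (ℛ k a)).left j *
      antipode k ((reprMap hC (ℛ k a)).right j) = Coalgebra.counit (R := k) a • (1 : H) := by
    rw [sum_mul_antipode_eq_smul, hC.ι_counit]
  calc _ = (ℛ k b).left i * (∑ j ∈ (reprMap hC (ℛ k a)).index, (reprMap hC (ℛ k a)).left j *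
      antipode k ((reprMap hC (ℛ k a)).right j)) * (PsiC t).ofConv ((ℛ k b).right i) := by
        rw [Finset.mul_sum, Finset.sum_mul]
        refine Finset.sum_congr rfl fun j _ => ?_
        have := Psi_mul hC ht ((ℛ k b).right i) ((ℛ k a).right j)
        simp only [reprMap] at *
        rw [this]
        simp only [mul_assoc]
    _ = _ := by rw [this]; simp

lemma aug_le (hC : CommByFinite k A H ι) (M : Submodule k H)
    (hM : ∀ (h : H) (a : A), Coalgebra.counit (R := k) a = 0 → h * ι a ∈ M) :
    augHIdeal k A H ι ≤ M := by
  refine Submodule.span_le.2 ?_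
  rintro _ ⟨a, h, ha, rfl⟩
  rw [SetLike.mem_coe, mul_eq_adr (ℛ k h)]
  refine M.sum_mem fun i _ => ?_
  obtain ⟨b, hb⟩ := hC.normal_right ((ℛ k h).right i) a
  rw [← hb]
  refine hM _ _ ?_
  rw [← hC.ι_counit, hb]
  exact counit_adr _ _ (by rw [hC.ι_counit, ha])

lemma hbar_of_right (hC : CommByFinite k A H ι) (t : Module.Dual k H)
    (h : ∀ (h : H) (a : A), Coalgebra.counit (R := k) a = 0 → t (h * ι a) = 0) :
    t ∈ hbarStar k A H ι := fun _ hx => aug_le hC (LinearMap.ker t) h hx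

lemma Phi_hbar (hC : CommByFinite k A H ι) {t : Module.Dual k H}
    (ht : t ∈ hbarStar k A H ι) (u : Module.Dual k H) :
    u ∘ₗ (PhiC t).ofConv ∈ hbarStar k A H ι :=
  hbar_of_right hC _ fun h a ha => by simp [Phi_mul hC ht, ha]

lemma Phi_one (t : Module.Dual k H) (ht : t 1 = 0) : (PhiC t).ofConv (1 : H) = 0 := by
  let R : Coalgebra.Repr k (1 : H) Unit :=
    ⟨{()}, fun _ => 1, fun _ => 1, by simp [Algebra.TensorProduct.one_def]⟩
  rw [PhiC_repr t R]
  simp [R, PsiC_repr t R, ht]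

lemma conv_one_apply (f g : Module.Dual k H) : conv k f g 1 = f 1 * g 1 := by
  simp [conv, Algebra.TensorProduct.one_def]

lemma antipode_hbar (hC : CommByFinite k A H ι) {t : Module.Dual k H}
    (ht : t ∈ hbarStar k A H ι) : t ∘ₗ antipode k ∈ hbarStar k A H ι := by
  intro x hx
  refine (Submodule.span_le (p := LinearMap.ker (t ∘ₗ antipode k))).2 ?_ hx
  rintro _ ⟨a, h, ha, rfl⟩
  change t (antipode k (ι a * h)) = 0
  rw [antipode_mul_antidistrib, ← hC.ι_antipode, hbar_right hC ht, counit_antipode, ha, zero_mul]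

lemma transl_hbar {t : Module.Dual k H}
    (ht : t ∈ hbarStar k A H ι) (y : H) : t ∘ₗ LinearMap.mulRight k y ∈ hbarStar k A H ι := by
  intro x hx
  refine (Submodule.span_le (p := LinearMap.ker (t ∘ₗ LinearMap.mulRight k y))).2 ?_ hx
  rintro _ ⟨a, h, ha, rfl⟩
  change t (ι a * h * y) = 0
  exact ht _ (Submodule.subset_span ⟨a, h * y, ha, by rw [mul_assoc]⟩)

lemma counit_hbar (hC : CommByFinite k A H ι) :
    (Coalgebra.counit : Module.Dual k H) ∈ hbarStar k A H ι :=
  hbar_of_right hC _ fun h a ha => by simp [hC.ι_counit, ha]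

lemma fg_right (hC : CommByFinite k A H ι) :
    ∃ T : Finset H, ∀ h : H, h ∈ ⨆ y ∈ T, LinearMap.range (LinearMap.mulLeft k y ∘ₗ ι) := by
  classical
  obtain ⟨s, hs⟩ := hC.finiteOver
  refine ⟨s.biUnion fun y => (ℛ k y).index.image (ℛ k y).left, fun h => ?_⟩
  have : h ∈ (⊤ : Submodule k H) := trivial
  rw [← hs] at this
  refine Submodule.span_le.2 ?_ this
  rintro _ ⟨a, y, hy, rfl⟩
  rw [SetLike.mem_coe, mul_eq_adr (ℛ k y)]
  refine Submodule.sum_mem _ fun i hi => ?_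
  obtain ⟨b, hb⟩ := hC.normal_right ((ℛ k y).right i) a
  rw [← hb]
  refine Submodule.mem_iSup_of_mem ((ℛ k y).left i) (Submodule.mem_iSup_of_mem ?_ ⟨b, rfl⟩)
  exact Finset.mem_biUnion.2 ⟨y, hy, Finset.mem_image_of_mem _ hi⟩

lemma PiDual_mem (hC : CommByFinite k A H ι) {p : H →ₗ[k] A} (hp : IsSplitting k A H ι p)
    {α : Module.Dual k A} (hα : α ∈ finDual k A) : PiDual k A H p α ∈ finDual k H := by
  obtain ⟨I, hI, hle, hfin⟩ := hα
  let L : Submodule H H := Submodule.span H (ι '' (I : Set A))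
  have hL' : ∀ x ∈ L, ∀ c : H, p (c * x) ∈ I := by
    intro x hx
    induction hx using Submodule.span_induction with
    | mem x hx =>
      obtain ⟨a, ha, rfl⟩ := hx
      intro c
      rw [hp.right_linear]; exact (hI _ a ha).1
    | zero => simp
    | add x y _ _ hx hy => intro c; rw [mul_add, map_add]; exact I.add_mem (hx c) (hy c)
    | smul d x hx' hx => intro c; rw [smul_eq_mul, ← mul_assoc]; exact hx _
  have hL : ∀ x ∈ L, p x ∈ I := fun x hx => by simpa using hL' x hx 1
  refine finDual_of_left _ L (fun x hx => hle (hL x hx)) ?_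
  obtain ⟨T, hT⟩ := fg_right hC
  let q : H →ₗ[k] H ⧸ L := L.mkQ.restrictScalars k
  let φ : H → A →ₗ[k] H ⧸ L := fun y => q ∘ₗ LinearMap.mulLeft k y ∘ₗ ι
  have hφ : ∀ y, I ≤ LinearMap.ker (φ y) := by
    intro y a ha
    change (Submodule.Quotient.mk (y * ι a) : H ⧸ L) = 0
    rw [Submodule.Quotient.mk_eq_zero]
    exact L.smul_mem y (Submodule.subset_span ⟨a, ha, rfl⟩)
  have hfg : ∀ y, (LinearMap.range (φ y)).FG := by
    intro y
    rw [← Submodule.range_liftQ I (φ y) (hφ y)]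
    exact Module.Finite.iff_fg.1 inferInstance
  refine ⟨?_⟩
  have htop : (⊤ : Submodule k (H ⧸ L)) = ⨆ y ∈ T, LinearMap.range (φ y) := by
    symm
    rw [eq_top_iff]
    rintro z -
    obtain ⟨h, rfl⟩ := Submodule.Quotient.mk_surjective L z
    have h1 := Submodule.mem_map_of_mem (f := q) (hT h)
    simp only [Submodule.map_iSup, ← LinearMap.range_comp] at h1
    exact h1
  rw [htop]
  exact Submodule.fg_biSup T _ fun y _ => hfg y

lemma res_mem (hC : CommByFinite k A H ι) {f : Module.Dual k H} (hf : f ∈ finDual k H) :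
    f ∘ₗ ι ∈ finDual k A := by
  obtain ⟨n, u, v, -, -, h⟩ := finDual_split' f hf
  refine finDual_of_sum _ (fun i => u i ∘ₗ ι) (fun i => v i ∘ₗ ι) fun x y => ?_
  simp [hC.ι_mul, h]

/-- generator set of `(H̄*)⁺H°` -/
def gens (k : Type) [Field k] (A : Type) [CommRing A] [HopfAlgebra k A]
    (H : Type) [Ring H] [HopfAlgebra k H] (ι : A →ₗ[k] H) : Set (Module.Dual k H) :=
  {x : Module.Dual k H | ∃ t g : Module.Dual k H,
        t ∈ finDual k H ∩ hbarStar k A H ι ∧ t 1 = 0 ∧ g ∈ finDual k H ∧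
        x = conv k t g}

lemma left_ideal (hC : CommByFinite k A H ι) {f g : Module.Dual k H}
    (hf : f ∈ Submodule.span k (gens k A H ι)) (hg : g ∈ finDual k H) :
    conv k g f ∈ Submodule.span k (gens k A H ι) := by
  induction hf using Submodule.span_induction with
  | mem x hx =>
    obtain ⟨t, g', ⟨ht, ht'⟩, ht1, hg', rfl⟩ := hx
    obtain ⟨n, u, v, hu, hv, h⟩ := finDual_split' g hg
    have e : conv k (conv k g t) g' =
        ∑ i, conv k (u i ∘ₗ (PhiC t).ofConv) (conv k (v i) g') := by
      rw [conv_swap g t u v h]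
      simp only [← conv_assoc']
      rw [conv_eq]
      simp only [conv_eq, toConv_sum, toConv_ofConv, Finset.sum_mul, ofConv_sum]
    rw [← conv_assoc', e]
    refine Submodule.sum_mem _ fun i _ => Submodule.subset_span
      ⟨_, _, ⟨finDual_Phi (hu i) ht, Phi_hbar hC ht' _⟩, ?_, finDual_conv (hv i) hg', rfl⟩
    rw [LinearMap.comp_apply, Phi_one t ht1, map_zero]
  | zero =>
    have : conv k g 0 = 0 := by ext; simp [conv]
    rw [this]; exact zero_mem _
  | add x y _ _ hx hy => rw [conv_add_right]; exact add_mem hx hy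
  | smul c x _ hx => rw [conv_smul_right]; exact Submodule.smul_mem _ _ hx

lemma right_ideal {f g : Module.Dual k H}
    (hf : f ∈ Submodule.span k (gens k A H ι)) (hg : g ∈ finDual k H) :
    conv k f g ∈ Submodule.span k (gens k A H ι) := by
  induction hf using Submodule.span_induction with
  | mem x hx =>
    obtain ⟨t, g', ht, ht1, hg', rfl⟩ := hx
    rw [conv_assoc']
    exact Submodule.subset_span ⟨t, _, ht, ht1, finDual_conv hg' hg, rfl⟩
  | zero =>
    have : conv k 0 g = 0 := by ext; simp [conv]
    rw [this]; exact zero_mem _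
  | add x y _ _ hx hy => rw [conv_add_left]; exact add_mem hx hy
  | smul c x _ hx => rw [conv_smul_left]; exact Submodule.smul_mem _ _ hx

/-- the coideal condition -/
def CoidP (S : Submodule k (Module.Dual k H)) (f : Module.Dual k H) : Prop :=
  ∃ (n m : ℕ) (s t : Fin n → Module.Dual k H) (u v : Fin m → Module.Dual k H),
      (∀ i, s i ∈ S ∧ t i ∈ finDual k H) ∧
      (∀ j, u j ∈ finDual k H ∧ v j ∈ S) ∧
      ∀ x y : H, f (x * y) = (∑ i, s i x * t i y) + ∑ j, u j x * v j y

lemma CoidP_of {S : Submodule k (Module.Dual k H)} {f : Module.Dual k H}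
    {κ μ : Type} [Fintype κ] [Fintype μ]
    (s t : κ → Module.Dual k H) (u v : μ → Module.Dual k H)
    (h1 : ∀ i, s i ∈ S ∧ t i ∈ finDual k H) (h2 : ∀ j, u j ∈ finDual k H ∧ v j ∈ S)
    (h : ∀ x y : H, f (x * y) = (∑ i, s i x * t i y) + ∑ j, u j x * v j y) : CoidP S f := by
  refine ⟨Fintype.card κ, Fintype.card μ, s ∘ (Fintype.equivFin κ).symm,
    t ∘ (Fintype.equivFin κ).symm, u ∘ (Fintype.equivFin μ).symm,
    v ∘ (Fintype.equivFin μ).symm, fun i => h1 _, fun j => h2 _, fun x y => ?_⟩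
  rw [h]
  congr 1
  · exact ((Fintype.equivFin κ).symm.sum_comp fun i => s i x * t i y).symm
  · exact ((Fintype.equivFin μ).symm.sum_comp fun i => u i x * v i y).symm

lemma coideal (hC : CommByFinite k A H ι) {f : Module.Dual k H}
    (hf : f ∈ Submodule.span k (gens k A H ι)) :
    CoidP (Submodule.span k (gens k A H ι)) f := by
  induction hf using Submodule.span_induction with
  | mem x hx =>
    obtain ⟨t, g, ⟨ht, ht'⟩, ht1, hg, rfl⟩ := hx
    obtain ⟨n, y, v, hv, h⟩ := finDual_split t ht
    obtain ⟨m, a, b, ha, hb, h'⟩ := finDual_split' g hg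
    -- `Δ t = Σ t'_i ⊗ v_i + ε ⊗ t`
    let t' : Fin n → Module.Dual k H := fun i =>
      t ∘ₗ LinearMap.mulRight k (y i) - t (y i) • (Coalgebra.counit : Module.Dual k H)
    have hsplit : ∀ x z, t (x * z) = ∑ o : Option (Fin n),
        (o.elim (Coalgebra.counit : Module.Dual k H) t') x * (o.elim t v) z := by
      intro x z
      have e := h 1 z
      simp only [one_mul] at e
      rw [Fintype.sum_option, h]
      simp only [Option.elim, t', LinearMap.sub_apply, LinearMap.smul_apply, sub_mul,
        Finset.sum_sub_distrib, LinearMap.comp_apply, LinearMap.mulRight_apply]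
      rw [e, Finset.mul_sum]
      simp [smul_eq_mul, mul_assoc, mul_left_comm]
    have hmul := conv_mul_apply t g _ _ a b hsplit h'
    refine CoidP_of (κ := Fin n × Fin m) (μ := Fin m)
      (fun q => conv k (t' q.1) (a q.2)) (fun q => conv k (v q.1) (b q.2))
      (fun j => conv k Coalgebra.counit (a j)) (fun j => conv k t (b j)) ?_ ?_ ?_
    · rintro ⟨i, j⟩
      refine ⟨Submodule.subset_span ⟨t' i, a j, ⟨?_, ?_⟩, ?_, ha j, rfl⟩,
        finDual_conv (hv i) (hb j)⟩
      · exact (FD k H).sub_mem (finDual_transl t ht _) (finDual_smul finDual_counit _)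
      · intro x hx
        simp only [t', LinearMap.sub_apply, LinearMap.smul_apply]
        rw [transl_hbar ht' _ x hx, counit_hbar hC x hx]; simp
      · simp [t']
    · intro j
      exact ⟨finDual_conv finDual_counit (ha j),
        Submodule.subset_span ⟨t, b j, ⟨ht, ht'⟩, ht1, hb j, rfl⟩⟩
    · intro x z
      rw [hmul, ← Finset.univ_product_univ, Finset.sum_product, Fintype.sum_option, add_comm,
        ← Finset.univ_product_univ, Finset.sum_product]
      rfl
  | zero =>
    exact CoidP_of (κ := Fin 0) (μ := Fin 0) (fun _ => 0) (fun _ => 0) (fun _ => 0) (fun _ => 0)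
      (fun i => i.elim0) (fun i => i.elim0) (by simp)
  | add x y _ _ hx hy =>
    obtain ⟨n, m, s, t, u, v, h1, h2, h3⟩ := hx
    obtain ⟨n', m', s', t', u', v', h1', h2', h3'⟩ := hy
    refine CoidP_of (Sum.elim s s') (Sum.elim t t') (Sum.elim u u') (Sum.elim v v') ?_ ?_ ?_
    · rintro (i | i)
      exacts [h1 i, h1' i]
    · rintro (i | i)
      exacts [h2 i, h2' i]
    · intro a b
      simp only [LinearMap.add_apply, h3, h3', Fintype.sum_sum_type, Sum.elim_inl, Sum.elim_inr]
      ring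
  | smul c x _ hx =>
    obtain ⟨n, m, s, t, u, v, h1, h2, h3⟩ := hx
    refine CoidP_of (fun i => c • s i) t u (fun i => c • v i)
      (fun i => ⟨Submodule.smul_mem _ _ (h1 i).1, (h1 i).2⟩)
      (fun i => ⟨(h2 i).1, Submodule.smul_mem _ _ (h2 i).2⟩) fun a b => ?_
    simp only [LinearMap.smul_apply, h3, smul_eq_mul, mul_add, Finset.mul_sum, mul_assoc,
      mul_left_comm]

lemma antip (hC : CommByFinite k A H ι) {f : Module.Dual k H}
    (hf : f ∈ Submodule.span k (gens k A H ι)) :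
    f ∘ₗ antipode k ∈ Submodule.span k (gens k A H ι) := by
  induction hf using Submodule.span_induction with
  | mem x hx =>
    obtain ⟨t, g, ⟨ht, ht'⟩, ht1, hg, rfl⟩ := hx
    have e : t ∘ₗ antipode k = conv k (t ∘ₗ antipode k) Coalgebra.counit := by
      have e1 : (toConv (Coalgebra.counit : H →ₗ[k] k)) = 1 := by
        ext x
        simp [LinearMap.convOne_def]
      rw [conv_eq, e1, mul_one]
    rw [conv_antipode]
    refine left_ideal hC ?_ (finDual_antipode hg)
    rw [e]
    exact Submodule.subset_span ⟨_, _, ⟨finDual_antipode ht, antipode_hbar hC ht'⟩, by simp [ht1],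
      finDual_counit, rfl⟩
  | zero => rw [LinearMap.zero_comp]; exact zero_mem _
  | add x y _ _ hx hy => rw [LinearMap.add_comp]; exact add_mem hx hy
  | smul c x _ hx => rw [LinearMap.smul_comp]; exact Submodule.smul_mem _ _ hx

lemma res_zero (hC : CommByFinite k A H ι) {f : Module.Dual k H}
    (hf : f ∈ Submodule.span k (gens k A H ι)) : f ∘ₗ ι = 0 := by
  induction hf using Submodule.span_induction with
  | mem x hx =>
    obtain ⟨t, g, ⟨ht, ht'⟩, ht1, hg, rfl⟩ := hx
    ext a
    rw [LinearMap.comp_apply, conv_repr (reprMap hC (ℛ k a))]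
    refine Finset.sum_eq_zero fun i _ => ?_
    have := hbar_right hC ht' 1 ((ℛ k a).left i)
    rw [one_mul, ht1, mul_zero] at this
    simp only [reprMap, this, zero_mul]
  | zero => rw [LinearMap.zero_comp]
  | add x y _ _ hx hy => rw [LinearMap.add_comp, hx, hy, add_zero]
  | smul c x _ hx => rw [LinearMap.smul_comp, hx, smul_zero]

lemma gens_sub (x : Module.Dual k H) (hx : x ∈ Submodule.span k (gens k A H ι)) :
    x ∈ finDual k H := by
  refine (Submodule.span_le (p := FD k H)).2 ?_ hx
  rintro _ ⟨t, g, ⟨ht, -⟩, -, hg, rfl⟩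
  exact finDual_conv ht hg

lemma gens_one (x : Module.Dual k H) (hx : x ∈ Submodule.span k (gens k A H ι)) : x 1 = 0 := by
  refine (Submodule.span_le (p := LinearMap.ker (LinearMap.applyₗ (R := k) (1 : H) :
    Module.Dual k H →ₗ[k] k))).2 ?_ hx
  rintro _ ⟨t, g, -, ht, -, rfl⟩
  change conv k t g 1 = 0
  rw [conv_one_apply, ht, zero_mul]

end Ext

end helpers

end Paper

open Paper in
/-- `(H̄*)⁺H°` is a Hopf ideal of `H°` contained in `ker ι°`,
and `H° = ker ι° ⊕ Π°(A°)`; consequently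
`(H̄*)⁺H° ⊕ Π°(A°) ⊆ ker ι° ⊕ Π°(A°) = H°`. The coideal property of the Hopf
ideal is expressed in pairing form: `Δ°(S) ⊆ S ⊗ H° + H° ⊗ S`. -/
theorem statement_3
    (k : Type) [Field k] [IsAlgClosed k]
    (A : Type) [CommRing A] [HopfAlgebra k A]
    (H : Type) [Ring H] [HopfAlgebra k H]
    (ι : A →ₗ[k] H) (p : H →ₗ[k] A)
    (hCbF : CommByFinite k A H ι)
    (hyp : StandingHyp k A H ι)
    (hsplit : IsSplitting k A H ι p)
    -- `S` is the ideal `(H̄*)⁺H°` of `H°`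
    (S : Submodule k (Module.Dual k H))
    (hS : S = Submodule.span k
      {x : Module.Dual k H | ∃ t g : Module.Dual k H,
        t ∈ finDual k H ∩ hbarStar k A H ι ∧ t 1 = 0 ∧ g ∈ finDual k H ∧
        x = conv k t g}) :
    -- `S ⊆ H°` and `S` is a two-sided ideal of `H°` for the convolution product
    (↑S ⊆ finDual k H) ∧
    (∀ f ∈ S, ∀ g ∈ finDual k H, conv k g f ∈ S ∧ conv k f g ∈ S) ∧
    -- `S` is a coideal : `ε°(S) = 0` and `Δ°(S) ⊆ S ⊗ H° + H° ⊗ S`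
    (∀ f ∈ S, f 1 = 0) ∧
    (∀ f ∈ S, ∃ (n m : ℕ) (s t : Fin n → Module.Dual k H)
        (u v : Fin m → Module.Dual k H),
      (∀ i, s i ∈ S ∧ t i ∈ finDual k H) ∧
      (∀ j, u j ∈ finDual k H ∧ v j ∈ S) ∧
      ∀ x y : H, f (x * y) = (∑ i, s i x * t i y) + ∑ j, u j x * v j y) ∧
    -- `S` is stable under the antipode of `H°`
    (∀ f ∈ S, f ∘ₗ HopfAlgebra.antipode (R := k) ∈ S) ∧
    -- `S` is contained in `ker ι°`
    (∀ f ∈ S, iotaDual k A H ι f = 0) ∧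
    -- `H° = ker ι° ⊕ Π°(A°)` : existence and directness of the decomposition
    (∀ f ∈ finDual k H, ∃ g ∈ finDual k H, ∃ α ∈ finDual k A,
      iotaDual k A H ι g = 0 ∧ f = g + PiDual k A H p α) ∧
    (∀ α ∈ finDual k A,
      iotaDual k A H ι (PiDual k A H p α) = 0 → PiDual k A H p α = 0) := by

  have hS' : S = Submodule.span k (gens k A H ι) := hS
  clear hS
  subst hS'
  refine ⟨fun x hx => gens_sub x hx, fun f hf g hg => ⟨left_ideal hCbF hf hg, right_ideal hf hg⟩,
    fun f hf => gens_one f hf, fun f hf => coideal hCbF hf, fun f hf => antip hCbF hf,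
    fun f hf => res_zero hCbF hf, fun f hf => ?_, fun α _ h => ?_⟩
  · have hα := res_mem hCbF hf
    have hPi := PiDual_mem hCbF hsplit hα
    refine ⟨f - PiDual k A H p (f ∘ₗ ι), (FD k H).sub_mem hf hPi, f ∘ₗ ι, hα, ?_, by simp⟩
    ext a
    simp [iotaDual, PiDual, hsplit.left_inv]
  · have : α = 0 := by
      ext a
      have := LinearMap.congr_fun h a
      simpa [iotaDual, PiDual, hsplit.left_inv] using this
    rw [this]; simp [PiDual]
end
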